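/- For every q₀,q₁ > 1, the map (a,b) ↦ dim_H π_{q₀,q₁}(Ω_{a,b}) is continuous on the set {a ∈ {0,1}^ℕ : a starts with digit 0} × {b ∈ {0,1}^ℕ : b starts with digit 1}, where {0,1}^ℕ carries the product topology. -/

import Mathlib

open Filter Topology

/-- The base corresponding to a digit: `q0` for digit `0` (`false`), `q1` for digit `1` (`true`). -/
noncomputable def qb (q0 q1 : ℝ) (d : Bool) : ℝ := if d then q1 else q0

/-- `piE q0 q1 i = Σ_{k=1}^∞ i_k / (q_{i_1} ⋯ q_{i_k})`, with 0-based indexing. -/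
noncomputable def piE (q0 q1 : ℝ) (i : ℕ → Bool) : ℝ :=
  ∑' k : ℕ, (if i k then (1 : ℝ) else 0) / ∏ j ∈ Finset.range (k + 1), qb q0 q1 (i j)

/-- Strict lexicographic order `≺` on binary sequences. -/
def lexLt (u v : ℕ → Bool) : Prop := ∃ n : ℕ, (∀ m, m < n → u m = v m) ∧ u n < v n

/-- Non-strict lexicographic order `⪯`. -/
def lexLe (u v : ℕ → Bool) : Prop := lexLt u v ∨ u = v

/-- The tail `i_{n+1} i_{n+2} ⋯` of a sequence (0-based: drop the first `n` entries). -/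
def shiftTail (i : ℕ → Bool) (n : ℕ) : ℕ → Bool := fun k => i (n + k)

/-- `Omega a b` : sequences none of whose tails lies in the open lexicographic interval `]a,b[`. -/
def Omega (a b : ℕ → Bool) : Set (ℕ → Bool) :=
  {i | ∀ n : ℕ, ¬ (lexLt a (shiftTail i n) ∧ lexLt (shiftTail i n) b)}

/-- `(a,b) ∈ W` : `a` starts with digit 0, `b` starts with digit 1, and `a, b ∈ Ω_{a,b}`. -/
def memW (a b : ℕ → Bool) : Prop :=
  a 0 = false ∧ b 0 = true ∧ a ∈ Omega a b ∧ b ∈ Omega a b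

/-- The set `L_{a,b,n}` of length-`n` prefixes of elements of `Ω_{a,b}`, as a finset. -/
noncomputable def Lwords (a b : ℕ → Bool) (n : ℕ) : Finset (Fin n → Bool) :=
  Set.Finite.toFinset
    (Set.toFinite {w : Fin n → Bool | ∃ i ∈ Omega a b, ∀ k : Fin n, i k.1 = w k})

/-- Topological entropy `h(Ω_{a,b}) = lim_{n→∞} (1/n) log #L_{a,b,n}`; the limit exists by
subadditivity, hence it coincides with the `limsup` used here. -/
noncomputable def entropy (a b : ℕ → Bool) : ℝ :=
  Filter.limsup (fun n : ℕ => Real.log ((Lwords a b n).card) / n) Filter.atTop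

/-! ### Words and sequences -/

/-- Prepend a digit. -/
def scons (d : Bool) (x : ℕ → Bool) : ℕ → Bool
  | 0 => d
  | n + 1 => x n

/-- Prepend a word. -/
def cat : List Bool → (ℕ → Bool) → (ℕ → Bool)
  | [], x => x
  | d :: w, x => scons d (cat w x)

/-- Prefix of length `n`. -/
def pre : ℕ → (ℕ → Bool) → List Bool
  | 0, _ => []
  | n + 1, x => x 0 :: pre n (shiftTail x 1)

/-- The weight of a word. -/
noncomputable def wt (p0 p1 : ℝ) : List Bool → ℝ
  | [] => 1
  | d :: w => wt p0 p1 w / qb p0 p1 d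

/-- The value of a digit. -/
noncomputable def dv (d : Bool) : ℝ := if d then 1 else 0

/-- The offset of a word. -/
noncomputable def off (p0 p1 : ℝ) : List Bool → ℝ
  | [] => 0
  | d :: w => (dv d + off p0 p1 w) / qb p0 p1 d

theorem shiftTail_zero (x : ℕ → Bool) : shiftTail x 0 = x := by
  funext k; simp [shiftTail]

theorem shiftTail_shiftTail (x : ℕ → Bool) (m n : ℕ) :
    shiftTail (shiftTail x m) n = shiftTail x (m + n) := by
  funext k; simp [shiftTail, add_assoc]

theorem shiftTail_scons (d : Bool) (x : ℕ → Bool) : shiftTail (scons d x) 1 = x := by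
  funext k; simp [shiftTail, Nat.add_comm 1 k, scons]

theorem shiftTail_scons_succ (d : Bool) (x : ℕ → Bool) (n : ℕ) :
    shiftTail (scons d x) (n + 1) = shiftTail x n := by
  rw [Nat.add_comm, ← shiftTail_shiftTail, shiftTail_scons]

theorem scons_eta (x : ℕ → Bool) : scons (x 0) (shiftTail x 1) = x := by
  funext k
  cases k with
  | zero => rfl
  | succ k => simp [scons, shiftTail, Nat.add_comm]

theorem cat_pre (n : ℕ) (x : ℕ → Bool) : cat (pre n x) (shiftTail x n) = x := by
  induction n generalizing x with
  | zero => simp [pre, cat, shiftTail_zero]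
  | succ n ih =>
    simp only [pre, cat]
    have := ih (shiftTail x 1)
    rw [shiftTail_shiftTail, Nat.add_comm] at this
    rw [this, scons_eta]

theorem length_pre (n : ℕ) (x : ℕ → Bool) : (pre n x).length = n := by
  induction n generalizing x with
  | zero => rfl
  | succ n ih => simp [pre, ih]

theorem pre_cat (w : List Bool) (x : ℕ → Bool) : pre w.length (cat w x) = w := by
  induction w with
  | nil => rfl
  | cons d w ih =>
    simp only [List.length_cons, pre, cat, shiftTail_scons, ih]
    rfl

theorem shiftTail_cat (w : List Bool) (x : ℕ → Bool) : shiftTail (cat w x) w.length = x := by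
  induction w with
  | nil => exact shiftTail_zero x
  | cons d w ih => simp only [List.length_cons, cat, shiftTail_scons_succ, ih]

theorem cat_append (v w : List Bool) (x : ℕ → Bool) : cat (v ++ w) x = cat v (cat w x) := by
  induction v with
  | nil => rfl
  | cons d v ih => simp [cat, ih]

theorem pre_add (m n : ℕ) (x : ℕ → Bool) : pre (m + n) x = pre m x ++ pre n (shiftTail x m) := by
  induction m generalizing x with
  | zero => simp [pre, shiftTail_zero]
  | succ m ih =>
    rw [show m + 1 + n = (m + n) + 1 by ring]
    simp only [pre, ih, shiftTail_shiftTail, List.cons_append, Nat.add_comm 1 m]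

theorem pre_congr {n : ℕ} {x y : ℕ → Bool} (h : ∀ m, m < n → x m = y m) : pre n x = pre n y := by
  induction n generalizing x y with
  | zero => rfl
  | succ n ih =>
    simp only [pre]
    rw [h 0 (Nat.succ_pos _), ih (x := shiftTail x 1) (y := shiftTail y 1)]
    intro m hm
    exact h (1 + m) (by omega)

theorem pre_inj {n : ℕ} {x y : ℕ → Bool} (h : pre n x = pre n y) : ∀ m, m < n → x m = y m := by
  induction n generalizing x y with
  | zero => intro m hm; omega
  | succ n ih =>
    simp only [pre, List.cons.injEq] at h
    intro m hm
    cases m with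
    | zero => exact h.1
    | succ m =>
      have := ih h.2 m (by omega)
      simpa [shiftTail, Nat.add_comm] using this

theorem shiftTail_apply_zero (x : ℕ → Bool) (n : ℕ) : shiftTail x n 0 = x n := by
  simp [shiftTail]

/-! ### Lexicographic order -/

theorem lex_trichotomy (x y : ℕ → Bool) : lexLt x y ∨ x = y ∨ lexLt y x := by
  by_cases h : x = y
  · exact Or.inr (Or.inl h)
  · have hne : ∃ n, x n ≠ y n := by
      by_contra hc
      push Not at hc
      exact h (funext hc)
    classical
    have h1 := Nat.find_spec hne
    have h2 : ∀ m, m < Nat.find hne → x m = y m := fun m hm => by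
      have := Nat.find_min hne hm
      simpa using this
    rcases lt_or_gt_of_ne h1 with h3 | h3
    · exact Or.inl ⟨_, h2, h3⟩
    · exact Or.inr (Or.inr ⟨_, fun m hm => (h2 m hm).symm, h3⟩)

theorem lexLt_asymm {x y : ℕ → Bool} (h : lexLt x y) : ¬ lexLt y x := by
  rintro ⟨m, hm, hm'⟩
  obtain ⟨n, hn, hn'⟩ := h
  rcases lt_trichotomy m n with h | h | h
  · rw [hn m h] at hm'; exact lt_irrefl _ hm'
  · subst h; exact lt_asymm hn' hm'
  · rw [hm n h] at hn'; exact lt_irrefl _ hn'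

theorem lexLt_trans {x y z : ℕ → Bool} (h : lexLt x y) (h' : lexLt y z) : lexLt x z := by
  obtain ⟨m, hm, hm'⟩ := h
  obtain ⟨n, hn, hn'⟩ := h'
  rcases lt_trichotomy m n with h | h | h
  · exact ⟨m, fun k hk => (hm k hk).trans (hn k (hk.trans h)), by rw [← hn m h]; exact hm'⟩
  · subst h; exact ⟨m, fun k hk => (hm k hk).trans (hn k hk), hm'.trans hn'⟩
  · exact ⟨n, fun k hk => (hm k (hk.trans h)).trans (hn k hk), by rw [hm n h]; exact hn'⟩

theorem lexLt_irrefl (x : ℕ → Bool) : ¬ lexLt x x := by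
  rintro ⟨m, _, hm'⟩; exact lt_irrefl _ hm'

theorem not_lexLt {x y : ℕ → Bool} : ¬ lexLt x y ↔ lexLe y x := by
  constructor
  · intro h
    rcases lex_trichotomy x y with h1 | h1 | h1
    · exact absurd h1 h
    · exact Or.inr h1.symm
    · exact Or.inl h1
  · rintro (h | h)
    · exact lexLt_asymm h
    · subst h; exact lexLt_irrefl _

theorem lexLe_trans {x y z : ℕ → Bool} (h : lexLe x y) (h' : lexLe y z) : lexLe x z := by
  rcases h with h | h
  · rcases h' with h' | h'
    · exact Or.inl (lexLt_trans h h')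
    · subst h'; exact Or.inl h
  · subst h; exact h'

theorem bool_lt_iff {a b : Bool} : a < b ↔ a = false ∧ b = true := by
  revert a b; decide

theorem lexLt_of_head {x y : ℕ → Bool} (hx : x 0 = false) (hy : y 0 = true) : lexLt x y :=
  ⟨0, fun m hm => absurd hm (Nat.not_lt_zero m), by rw [hx, hy]; decide⟩

theorem isOpen_lexLt : IsOpen {p : (ℕ → Bool) × (ℕ → Bool) | lexLt p.1 p.2} := by
  have : {p : (ℕ → Bool) × (ℕ → Bool) | lexLt p.1 p.2} =
      ⋃ n : ℕ, {p | (∀ m, m < n → p.1 m = p.2 m) ∧ p.1 n < p.2 n} := by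
    ext p; simp [lexLt]
  rw [this]
  refine isOpen_iUnion fun n => ?_
  have hc : ∀ m : ℕ, Continuous fun p : (ℕ → Bool) × (ℕ → Bool) => (p.1 m, p.2 m) := fun m => by
    fun_prop
  have h1 : IsOpen {p : (ℕ → Bool) × (ℕ → Bool) | ∀ m, m < n → p.1 m = p.2 m} := by
    have : {p : (ℕ → Bool) × (ℕ → Bool) | ∀ m, m < n → p.1 m = p.2 m} =
      ⋂ m ∈ Set.Iio n, {p | p.1 m = p.2 m} := by
      ext p; simp
    rw [this]
    refine (Set.finite_Iio n).isOpen_biInter fun m _ => ?_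
    exact (isOpen_discrete {q : Bool × Bool | q.1 = q.2}).preimage (hc m)
  exact h1.inter ((isOpen_discrete {q : Bool × Bool | q.1 < q.2}).preimage (hc n))

theorem isClosed_lexLe : IsClosed {p : (ℕ → Bool) × (ℕ → Bool) | lexLe p.1 p.2} := by
  have : {p : (ℕ → Bool) × (ℕ → Bool) | lexLe p.1 p.2} =
      (Prod.swap ⁻¹' {p : (ℕ → Bool) × (ℕ → Bool) | lexLt p.1 p.2})ᶜ := by
    ext p; simp [not_lexLt]
  rw [this]
  exact (isOpen_lexLt.preimage continuous_swap).isClosed_compl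

theorem continuous_shiftTail (n : ℕ) : Continuous fun x : ℕ → Bool => shiftTail x n := by
  unfold shiftTail; fun_prop

/-- The graph of `Omega` is closed. -/
theorem isClosed_Omega : IsClosed {p : ((ℕ → Bool) × (ℕ → Bool)) × (ℕ → Bool) |
    p.2 ∈ Omega p.1.1 p.1.2} := by
  have : {p : ((ℕ → Bool) × (ℕ → Bool)) × (ℕ → Bool) | p.2 ∈ Omega p.1.1 p.1.2} =
      ⋂ n : ℕ, ({p | lexLt p.1.1 (shiftTail p.2 n)} ∩ {p | lexLt (shiftTail p.2 n) p.1.2})ᶜ := by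
    ext p; simp [Omega]
  rw [this]
  refine isClosed_iInter fun n => IsOpen.isClosed_compl ?_
  have h := continuous_shiftTail n
  refine IsOpen.inter ?_ ?_
  · exact isOpen_lexLt.preimage (f := fun p : ((ℕ → Bool) × (ℕ → Bool)) × (ℕ → Bool) =>
      (p.1.1, shiftTail p.2 n)) (by fun_prop)
  · exact isOpen_lexLt.preimage (f := fun p : ((ℕ → Bool) × (ℕ → Bool)) × (ℕ → Bool) =>
      (shiftTail p.2 n, p.1.2)) (by fun_prop)

theorem isClosed_Omega' (a b : ℕ → Bool) : IsClosed (Omega a b) :=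
  isClosed_Omega.preimage (f := fun x : ℕ → Bool => ((a, b), x)) (by fun_prop)

theorem Omega_shift {a b x : ℕ → Bool} (hx : x ∈ Omega a b) (n : ℕ) :
    shiftTail x n ∈ Omega a b := by
  intro m
  rw [shiftTail_shiftTail]
  exact hx (n + m)

theorem Omega_le {a b x : ℕ → Bool} (hb : b 0 = true) (hx : x ∈ Omega a b) (h0 : x 0 = false) :
    lexLe x a := by
  have h := hx 0
  rw [shiftTail_zero] at h
  exact not_lexLt.1 fun h1 => h ⟨h1, lexLt_of_head h0 hb⟩

theorem Omega_ge {a b x : ℕ → Bool} (ha : a 0 = false) (hx : x ∈ Omega a b) (h0 : x 0 = true) :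
    lexLe b x := by
  have h := hx 0
  rw [shiftTail_zero] at h
  exact not_lexLt.1 fun h1 => h ⟨lexLt_of_head ha h0, h1⟩

theorem mem_Omega_of {a b x : ℕ → Bool}
    (h0 : ∀ n, x n = false → lexLe (shiftTail x n) a)
    (h1 : ∀ n, x n = true → lexLe b (shiftTail x n)) : x ∈ Omega a b := by
  rintro n ⟨h2, h3⟩
  cases h : x n with
  | false => exact not_lexLt.2 (h0 n h) h2
  | true => exact not_lexLt.2 (h1 n h) h3

/-! ### The projection -/

theorem qb_gt_one {p0 p1 : ℝ} (h0 : 1 < p0) (h1 : 1 < p1) (d : Bool) : 1 < qb p0 p1 d := by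
  cases d <;> simpa [qb]

theorem qb_pos {p0 p1 : ℝ} (h0 : 1 < p0) (h1 : 1 < p1) (d : Bool) : 0 < qb p0 p1 d :=
  zero_lt_one.trans (qb_gt_one h0 h1 d)

/-- The smaller base. -/
noncomputable def lam (p0 p1 : ℝ) : ℝ := min p0 p1

theorem lam_gt_one {p0 p1 : ℝ} (h0 : 1 < p0) (h1 : 1 < p1) : 1 < lam p0 p1 := lt_min h0 h1

theorem lam_le_qb (p0 p1 : ℝ) (d : Bool) : lam p0 p1 ≤ qb p0 p1 d := by
  cases d
  · exact min_le_left _ _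
  · exact min_le_right _ _

theorem lam_pow_le_prod {p0 p1 : ℝ} (h0 : 1 < p0) (h1 : 1 < p1) (x : ℕ → Bool) (k : ℕ) :
    lam p0 p1 ^ k ≤ ∏ j ∈ Finset.range k, qb p0 p1 (x j) := by
  have hl := lam_gt_one h0 h1
  induction k with
  | zero => simp
  | succ k ih =>
    rw [Finset.prod_range_succ, pow_succ]
    exact mul_le_mul ih (lam_le_qb _ _ _) (by linarith) ((by positivity : (0:ℝ) ≤ _).trans ih)

theorem term_bound {p0 p1 : ℝ} (h0 : 1 < p0) (h1 : 1 < p1) (x : ℕ → Bool) (k : ℕ) :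
    ‖(if x k then (1 : ℝ) else 0) / ∏ j ∈ Finset.range (k + 1), qb p0 p1 (x j)‖ ≤
      (lam p0 p1)⁻¹ ^ (k + 1) := by
  have hl := lam_gt_one h0 h1
  have h := lam_pow_le_prod h0 h1 x (k + 1)
  have hp : 0 < lam p0 p1 ^ (k + 1) := by positivity
  rw [norm_div, Real.norm_of_nonneg (hp.le.trans h), inv_pow, div_eq_mul_inv]
  have h2 : ‖(if x k then (1 : ℝ) else 0)‖ ≤ 1 := by split_ifs <;> simp
  calc _ ≤ 1 * (∏ j ∈ Finset.range (k + 1), qb p0 p1 (x j))⁻¹ := by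
        gcongr
        exact inv_nonneg.2 (hp.le.trans h)
    _ ≤ _ := by rw [one_mul]; exact inv_anti₀ hp h

theorem summable_bound {p0 p1 : ℝ} (h0 : 1 < p0) (h1 : 1 < p1) :
    Summable fun k : ℕ => (lam p0 p1)⁻¹ ^ (k + 1) := by
  have hl := lam_gt_one h0 h1
  exact (summable_nat_add_iff 1).2
    (summable_geometric_of_lt_one (by positivity) (inv_lt_one_of_one_lt₀ hl))

theorem piE_summable {p0 p1 : ℝ} (h0 : 1 < p0) (h1 : 1 < p1) (x : ℕ → Bool) :
    Summable fun k : ℕ => (if x k then (1 : ℝ) else 0) /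
      ∏ j ∈ Finset.range (k + 1), qb p0 p1 (x j) :=
  Summable.of_norm_bounded (summable_bound h0 h1) (term_bound h0 h1 x)

theorem piE_continuous {p0 p1 : ℝ} (h0 : 1 < p0) (h1 : 1 < p1) : Continuous (piE p0 p1) := by
  have hl := lam_gt_one h0 h1
  unfold piE
  refine continuous_tsum (u := fun k : ℕ => (lam p0 p1)⁻¹ ^ (k + 1)) (fun k => ?_)
    (summable_bound h0 h1) (fun k x => term_bound h0 h1 x k)
  refine Continuous.div ?_ ?_ fun x => ?_
  · exact (continuous_of_discreteTopology (f := fun d : Bool => if d then (1 : ℝ) else 0)).comp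
      (continuous_apply k)
  · refine continuous_finsetProd _ fun j _ => ?_
    exact (continuous_of_discreteTopology (f := qb p0 p1)).comp (continuous_apply j)
  · exact (lt_of_lt_of_le (by positivity) (lam_pow_le_prod h0 h1 x (k + 1))).ne'

theorem piE_rec {p0 p1 : ℝ} (h0 : 1 < p0) (h1 : 1 < p1) (x : ℕ → Bool) :
    piE p0 p1 x = (dv (x 0) + piE p0 p1 (shiftTail x 1)) / qb p0 p1 (x 0) := by
  have hq := (qb_pos h0 h1 (x 0)).ne'
  unfold piE
  rw [(piE_summable h0 h1 x).tsum_eq_zero_add, add_div, ← tsum_div_const]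
  congr 1
  · simp [dv]
  · refine tsum_congr fun k => ?_
    rw [Finset.prod_range_succ', div_div]
    simp only [shiftTail, Nat.add_comm 1]

theorem piE_scons {p0 p1 : ℝ} (h0 : 1 < p0) (h1 : 1 < p1) (d : Bool) (x : ℕ → Bool) :
    piE p0 p1 (scons d x) = (dv d + piE p0 p1 x) / qb p0 p1 d := by
  rw [piE_rec h0 h1, shiftTail_scons]; rfl

theorem piE_cat {p0 p1 : ℝ} (h0 : 1 < p0) (h1 : 1 < p1) (w : List Bool) (x : ℕ → Bool) :
    piE p0 p1 (cat w x) = off p0 p1 w + wt p0 p1 w * piE p0 p1 x := by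
  induction w with
  | nil => simp [cat, off, wt]
  | cons d w ih =>
    simp only [cat, off, wt, piE_scons h0 h1, ih]
    ring

theorem piE_pre {p0 p1 : ℝ} (h0 : 1 < p0) (h1 : 1 < p1) (n : ℕ) (x : ℕ → Bool) :
    piE p0 p1 x = off p0 p1 (pre n x) + wt p0 p1 (pre n x) * piE p0 p1 (shiftTail x n) := by
  rw [← piE_cat h0 h1, cat_pre]

theorem wt_pos {p0 p1 : ℝ} (h0 : 1 < p0) (h1 : 1 < p1) (w : List Bool) : 0 < wt p0 p1 w := by
  induction w with
  | nil => simp [wt]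
  | cons d w ih => exact div_pos ih (qb_pos h0 h1 d)

theorem wt_le {p0 p1 : ℝ} (h0 : 1 < p0) (h1 : 1 < p1) (w : List Bool) :
    wt p0 p1 w ≤ (lam p0 p1)⁻¹ ^ w.length := by
  have hl := lam_gt_one h0 h1
  induction w with
  | nil => simp [wt]
  | cons d w ih =>
    simp only [wt, List.length_cons, pow_succ, div_eq_mul_inv]
    exact mul_le_mul ih (inv_anti₀ (by positivity) (lam_le_qb _ _ _))
      (inv_nonneg.2 (qb_pos h0 h1 d).le) (by positivity)

theorem wt_append (p0 p1 : ℝ) (v w : List Bool) :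
    wt p0 p1 (v ++ w) = wt p0 p1 v * wt p0 p1 w := by
  induction v with
  | nil => simp [wt]
  | cons d v ih => simp only [List.cons_append, wt, ih]; ring

theorem piE_nonneg {p0 p1 : ℝ} (h0 : 1 < p0) (h1 : 1 < p1) (x : ℕ → Bool) : 0 ≤ piE p0 p1 x := by
  refine tsum_nonneg fun k => div_nonneg (by split_ifs <;> simp) ?_
  exact Finset.prod_nonneg fun j _ => (qb_pos h0 h1 _).le

/-- The largest value of the projection. -/
noncomputable def Mx (p1 : ℝ) : ℝ := 1 / (p1 - 1)

theorem Mx_pos {p1 : ℝ} (h1 : 1 < p1) : 0 < Mx p1 := by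
  unfold Mx; exact div_pos one_pos (by linarith)

theorem Mx_eq {p1 : ℝ} (h1 : 1 < p1) : p1 * Mx p1 - 1 = Mx p1 := by
  unfold Mx
  have : p1 - 1 ≠ 0 := by linarith
  field_simp
  ring

theorem piE_le {p0 p1 : ℝ} (h0 : 1 < p0) (h1 : 1 < p1) (x : ℕ → Bool) :
    piE p0 p1 x ≤ Mx p1 := by
  obtain ⟨y, -, hy⟩ := isCompact_univ.exists_isMaxOn (Set.univ_nonempty (α := ℕ → Bool))
    (piE_continuous h0 h1).continuousOn
  have hy' : ∀ z, piE p0 p1 z ≤ piE p0 p1 y := fun z => hy (Set.mem_univ z)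
  refine (hy' x).trans ?_
  have h2 := piE_rec h0 h1 y
  have h3 := hy' (shiftTail y 1)
  have hM := Mx_pos h1
  have hE := Mx_eq h1
  rw [eq_div_iff (qb_pos h0 h1 _).ne'] at h2
  cases h : y 0 with
  | false =>
    simp [h, dv, qb] at h2
    nlinarith
  | true =>
    simp [h, dv, qb] at h2
    nlinarith

theorem piE_false {p0 p1 : ℝ} (h0 : 1 < p0) (h1 : 1 < p1) {x : ℕ → Bool} (hx : x 0 = false) :
    piE p0 p1 x = piE p0 p1 (shiftTail x 1) / p0 := by
  rw [piE_rec h0 h1, hx]; simp [dv, qb]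

theorem piE_true {p0 p1 : ℝ} (h0 : 1 < p0) (h1 : 1 < p1) {x : ℕ → Bool} (hx : x 0 = true) :
    piE p0 p1 x = (1 + piE p0 p1 (shiftTail x 1)) / p1 := by
  rw [piE_rec h0 h1, hx]; simp [dv, qb]

theorem piE_false_le {p0 p1 : ℝ} (h0 : 1 < p0) (h1 : 1 < p1) {x : ℕ → Bool} (hx : x 0 = false) :
    piE p0 p1 x ≤ Mx p1 / p0 := by
  rw [piE_false h0 h1 hx]
  have := piE_le h0 h1 (shiftTail x 1)
  gcongr

theorem piE_true_ge {p0 p1 : ℝ} (h0 : 1 < p0) (h1 : 1 < p1) {x : ℕ → Bool} (hx : x 0 = true) :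
    1 / p1 ≤ piE p0 p1 x := by
  rw [piE_true h0 h1 hx]
  have := piE_nonneg h0 h1 (shiftTail x 1)
  gcongr
  linarith

/-- Values of two sequences with a common prefix. -/
theorem piE_sub {p0 p1 : ℝ} (h0 : 1 < p0) (h1 : 1 < p1) {n : ℕ} {x y : ℕ → Bool}
    (h : ∀ m, m < n → x m = y m) :
    piE p0 p1 y - piE p0 p1 x =
      wt p0 p1 (pre n x) * (piE p0 p1 (shiftTail y n) - piE p0 p1 (shiftTail x n)) := by
  rw [piE_pre h0 h1 n x, piE_pre h0 h1 n y, pre_congr h]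
  ring

theorem piE_constTrue {p0 p1 : ℝ} (h0 : 1 < p0) (h1 : 1 < p1) :
    piE p0 p1 (fun _ => true) = Mx p1 := by
  have h := piE_true h0 h1 (x := fun _ => true) rfl
  rw [show shiftTail (fun _ => true) 1 = fun _ => true from rfl, eq_div_iff (by linarith)] at h
  unfold Mx
  rw [eq_div_iff (by linarith)]
  linarith

theorem piE_constFalse {p0 p1 : ℝ} (h0 : 1 < p0) (h1 : 1 < p1) :
    piE p0 p1 (fun _ => false) = 0 := by
  simp [piE]

/-! ### The sets `XX` -/

/-- Sequences all of whose tails respect the threshold `c`. -/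
def XX (p0 p1 c : ℝ) : Set (ℕ → Bool) :=
  {x | ∀ n, (x n = false → piE p0 p1 (shiftTail x n) ≤ c) ∧
    (x n = true → c ≤ piE p0 p1 (shiftTail x n))}

theorem XX_shift {p0 p1 c : ℝ} {x : ℕ → Bool} (hx : x ∈ XX p0 p1 c) (n : ℕ) :
    shiftTail x n ∈ XX p0 p1 c := by
  intro m
  rw [shiftTail_shiftTail]
  exact hx (n + m)

theorem XX_mono {p0 p1 c : ℝ} (h0 : 1 < p0) (h1 : 1 < p1) {x y : ℕ → Bool}
    (hx : x ∈ XX p0 p1 c) (hy : y ∈ XX p0 p1 c) (h : lexLt x y) : piE p0 p1 x ≤ piE p0 p1 y := by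
  obtain ⟨n, hn, hlt⟩ := h
  obtain ⟨hf, ht⟩ := bool_lt_iff.1 hlt
  have h2 := piE_sub h0 h1 hn
  have h3 := (hx n).1 hf
  have h4 := (hy n).2 ht
  have h5 := mul_nonneg (wt_pos h0 h1 (pre n x)).le
    (by linarith : 0 ≤ piE p0 p1 (shiftTail y n) - piE p0 p1 (shiftTail x n))
  linarith

theorem XX_lt {p0 p1 c : ℝ} (h0 : 1 < p0) (h1 : 1 < p1) {x y : ℕ → Bool}
    (hx : x ∈ XX p0 p1 c) (hy : y ∈ XX p0 p1 c) (h : piE p0 p1 x < piE p0 p1 y) : lexLt x y := by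
  rcases lex_trichotomy x y with h2 | h2 | h2
  · exact h2
  · subst h2; exact absurd h (lt_irrefl _)
  · exact absurd (XX_mono h0 h1 hy hx h2) (not_le.2 h)

theorem isClosed_XX {p0 p1 : ℝ} (h0 : 1 < p0) (h1 : 1 < p1) :
    IsClosed {p : ℝ × (ℕ → Bool) | p.2 ∈ XX p0 p1 p.1} := by
  have hcont := piE_continuous h0 h1
  have : {p : ℝ × (ℕ → Bool) | p.2 ∈ XX p0 p1 p.1} =
      ⋂ n : ℕ, (({p | p.2 n = false}ᶜ ∪ {p | piE p0 p1 (shiftTail p.2 n) ≤ p.1}) ∩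
        ({p | p.2 n = true}ᶜ ∪ {p | p.1 ≤ piE p0 p1 (shiftTail p.2 n)})) := by
    ext p
    simp only [XX, Set.mem_setOf_eq, Set.mem_iInter, Set.mem_inter_iff, Set.mem_union,
      Set.mem_compl_iff, imp_iff_not_or]
  rw [this]
  have hs : ∀ n, Continuous fun p : ℝ × (ℕ → Bool) => piE p0 p1 (shiftTail p.2 n) := fun n =>
    hcont.comp ((continuous_shiftTail n).comp continuous_snd)
  have hd : ∀ n (d : Bool), IsClosed {p : ℝ × (ℕ → Bool) | p.2 n = d}ᶜ := fun n d =>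
    IsOpen.isClosed_compl ((isOpen_discrete {d}).preimage
      ((continuous_apply n).comp continuous_snd : Continuous fun p : ℝ × (ℕ → Bool) => p.2 n))
  refine isClosed_iInter fun n => IsClosed.inter (IsClosed.union (hd n _) ?_)
    (IsClosed.union (hd n _) ?_)
  · exact isClosed_le (hs n) continuous_fst
  · exact isClosed_le continuous_fst (hs n)

theorem isClosed_XX' {p0 p1 : ℝ} (h0 : 1 < p0) (h1 : 1 < p1) (c : ℝ) :
    IsClosed (XX p0 p1 c) :=
  (isClosed_XX h0 h1).preimage (f := fun x : ℕ → Bool => (c, x)) (by fun_prop)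

/-- The upper condition: the hole contains the hole of a threshold system. -/
def UU (p0 p1 : ℝ) (a b : ℕ → Bool) : Prop :=
  ∃ c ∈ Set.Icc (1 / p1) (Mx p1 / p0), ∃ a' ∈ XX p0 p1 c, ∃ b' ∈ XX p0 p1 c,
    a' 0 = false ∧ b' 0 = true ∧ lexLe a a' ∧ lexLe b' b

theorem pre_wt_le {p0 p1 : ℝ} (h0 : 1 < p0) (h1 : 1 < p1) {n : ℕ} (hn : 0 < n) (x : ℕ → Bool) :
    wt p0 p1 (pre n x) ≤ (lam p0 p1)⁻¹ := by
  have hl := lam_gt_one h0 h1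
  refine (wt_le h0 h1 _).trans ?_
  rw [length_pre]
  exact pow_le_of_le_one (by positivity) (inv_le_one_of_one_le₀ hl.le) hn.ne'

theorem Omega_subset_left {p0 p1 c : ℝ} (h0 : 1 < p0) (h1 : 1 < p1) {a b a' : ℕ → Bool}
    (hb : b 0 = true) (ha' : a' ∈ XX p0 p1 c) (ha0 : a' 0 = false) (haa : lexLe a a') :
    ∀ x ∈ Omega a b, x 0 = false → piE p0 p1 x ≤ c := by
  have hl := lam_gt_one h0 h1
  set r := (lam p0 p1)⁻¹ with hr
  have hr0 : 0 < r := by positivity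
  have hr1 : r < 1 := inv_lt_one_of_one_lt₀ hl
  have hac : piE p0 p1 a' ≤ c := by simpa [shiftTail_zero] using (ha' 0).1 ha0
  -- contraction argument
  have key : ∀ B : ℝ, 0 ≤ B → (∀ x ∈ Omega a b, x 0 = false → piE p0 p1 x ≤ c + B) →
      (∀ x ∈ Omega a b, x 0 = false → piE p0 p1 x ≤ c + r * B) := by
    intro B hB hx x hxO hx0
    have hxa := lexLe_trans (Omega_le hb hxO hx0) haa
    rcases hxa with ⟨n, hn, hlt⟩ | rfl
    · obtain ⟨hf, ht⟩ := bool_lt_iff.1 hlt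
      have hnpos : 0 < n := by
        rcases Nat.eq_zero_or_pos n with h | h
        · subst h; rw [ha0] at ht; exact absurd ht (by decide)
        · exact h
      have h2 := piE_sub h0 h1 hn
      have h3 := (ha' n).2 ht
      have h4 := hx _ (Omega_shift hxO n) (by rw [shiftTail_apply_zero, hf])
      have h5 := pre_wt_le h0 h1 hnpos x
      have h6 := wt_pos h0 h1 (pre n x)
      have h7 : wt p0 p1 (pre n x) * (piE p0 p1 (shiftTail x n) - piE p0 p1 (shiftTail a' n)) ≤
          wt p0 p1 (pre n x) * B := mul_le_mul_of_nonneg_left (by linarith) h6.le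
      have h8 : wt p0 p1 (pre n x) * B ≤ r * B := mul_le_mul_of_nonneg_right h5 hB
      nlinarith
    · have := mul_nonneg hr0.le hB
      linarith
  have key2 : ∀ n : ℕ, ∀ x ∈ Omega a b, x 0 = false →
      piE p0 p1 x ≤ c + r ^ n * (Mx p1 + |c|) := by
    intro n
    have hM := Mx_pos h1
    induction n with
    | zero =>
      intro x _ _
      have := piE_le h0 h1 x
      have := neg_abs_le c
      linarith
    | succ n ih =>
      intro x hx hx0
      have := key _ (by positivity) ih x hx hx0
      rw [pow_succ]
      linarith
  intro x hx hx0
  have ht : Tendsto (fun n : ℕ => c + r ^ n * (Mx p1 + |c|)) atTop (𝓝 (c + 0 * (Mx p1 + |c|))) :=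
    ((tendsto_pow_atTop_nhds_zero_of_lt_one hr0.le hr1).mul_const _).const_add c
  have := ge_of_tendsto' ht fun n => key2 n x hx hx0
  simpa using this

theorem Omega_subset_right {p0 p1 c : ℝ} (h0 : 1 < p0) (h1 : 1 < p1) {a b b' : ℕ → Bool}
    (ha : a 0 = false) (hb' : b' ∈ XX p0 p1 c) (hb0 : b' 0 = true) (hbb : lexLe b' b) :
    ∀ x ∈ Omega a b, x 0 = true → c ≤ piE p0 p1 x := by
  have hl := lam_gt_one h0 h1
  set r := (lam p0 p1)⁻¹ with hr
  have hr0 : 0 < r := by positivity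
  have hr1 : r < 1 := inv_lt_one_of_one_lt₀ hl
  have hbc : c ≤ piE p0 p1 b' := by simpa [shiftTail_zero] using (hb' 0).2 hb0
  have key : ∀ B : ℝ, 0 ≤ B → (∀ x ∈ Omega a b, x 0 = true → c - B ≤ piE p0 p1 x) →
      (∀ x ∈ Omega a b, x 0 = true → c - r * B ≤ piE p0 p1 x) := by
    intro B hB hx x hxO hx0
    have hxa := lexLe_trans hbb (Omega_ge ha hxO hx0)
    rcases hxa with ⟨n, hn, hlt⟩ | rfl
    · obtain ⟨hf, ht⟩ := bool_lt_iff.1 hlt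
      have hnpos : 0 < n := by
        rcases Nat.eq_zero_or_pos n with h | h
        · subst h; rw [hb0] at hf; exact absurd hf (by decide)
        · exact h
      have h2 := piE_sub h0 h1 hn
      have h3 := (hb' n).1 hf
      have h4 := hx _ (Omega_shift hxO n) (by rw [shiftTail_apply_zero, ht])
      have h5 := pre_wt_le h0 h1 hnpos b'
      have h6 := wt_pos h0 h1 (pre n b')
      have h7 : wt p0 p1 (pre n b') * (piE p0 p1 (shiftTail b' n) - piE p0 p1 (shiftTail x n)) ≤
          wt p0 p1 (pre n b') * B := mul_le_mul_of_nonneg_left (by linarith) h6.le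
      have h8 : wt p0 p1 (pre n b') * B ≤ r * B := mul_le_mul_of_nonneg_right h5 hB
      nlinarith
    · have := mul_nonneg hr0.le hB
      linarith
  have key2 : ∀ n : ℕ, ∀ x ∈ Omega a b, x 0 = true →
      c - r ^ n * |c| ≤ piE p0 p1 x := by
    intro n
    induction n with
    | zero =>
      intro x _ _
      have := piE_nonneg h0 h1 x
      have := le_abs_self c
      linarith
    | succ n ih =>
      intro x hx hx0
      have := key _ (by positivity) ih x hx hx0
      rw [pow_succ]
      linarith
  intro x hx hx0
  have ht : Tendsto (fun n : ℕ => c - r ^ n * |c|) atTop (𝓝 (c - 0 * |c|)) :=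
    ((tendsto_pow_atTop_nhds_zero_of_lt_one hr0.le hr1).mul_const _).const_sub c
  have := le_of_tendsto' ht fun n => key2 n x hx hx0
  simpa using this

theorem Omega_subset_XX {p0 p1 c : ℝ} (h0 : 1 < p0) (h1 : 1 < p1) {a b a' b' : ℕ → Bool}
    (ha : a 0 = false) (hb : b 0 = true) (ha' : a' ∈ XX p0 p1 c) (hb' : b' ∈ XX p0 p1 c)
    (ha0 : a' 0 = false) (hb0 : b' 0 = true) (haa : lexLe a a') (hbb : lexLe b' b) :
    Omega a b ⊆ XX p0 p1 c := by
  intro x hx n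
  constructor
  · intro h
    exact Omega_subset_left h0 h1 hb ha' ha0 haa _ (Omega_shift hx n)
      (by rw [shiftTail_apply_zero, h])
  · intro h
    exact Omega_subset_right h0 h1 ha hb' hb0 hbb _ (Omega_shift hx n)
      (by rw [shiftTail_apply_zero, h])

/-! ### Itineraries -/

/-- The piecewise linear map associated to a digit rule. -/
noncomputable def TT (p0 p1 : ℝ) (R : ℝ → Bool) (x : ℝ) : ℝ :=
  if R x then p1 * x - 1 else p0 * x

/-- The itinerary of a point. -/
noncomputable def itin (p0 p1 : ℝ) (R : ℝ → Bool) (x : ℝ) : ℕ → Bool :=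
  fun n => R ((TT p0 p1 R)^[n] x)

/-- A digit rule is compatible with the threshold `c`. -/
def RuleOK (c : ℝ) (R : ℝ → Bool) : Prop :=
  ∀ y, (R y = false → y ≤ c) ∧ (R y = true → c ≤ y)

theorem shiftTail_itin (p0 p1 : ℝ) (R : ℝ → Bool) (x : ℝ) (n : ℕ) :
    shiftTail (itin p0 p1 R x) n = itin p0 p1 R ((TT p0 p1 R)^[n] x) := by
  funext k
  simp only [shiftTail, itin]
  rw [Nat.add_comm, Function.iterate_add_apply]

theorem TT_mem {p0 p1 c : ℝ} (h0 : 1 < p0) (h1 : 1 < p1) {R : ℝ → Bool} (hR : RuleOK c R)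
    (hc : c ∈ Set.Icc (1 / p1) (Mx p1 / p0)) {x : ℝ} (hx : x ∈ Set.Icc 0 (Mx p1)) :
    TT p0 p1 R x ∈ Set.Icc 0 (Mx p1) := by
  obtain ⟨hc1, hc2⟩ := hc
  rw [div_le_iff₀ (by linarith)] at hc1
  rw [le_div_iff₀ (by linarith)] at hc2
  have hE := Mx_eq h1
  unfold TT
  cases h : R x with
  | false =>
    have := (hR x).1 h
    simp only [Bool.false_eq_true, if_false]
    constructor
    · exact mul_nonneg (by linarith) hx.1
    · nlinarith
  | true =>
    have := (hR x).2 h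
    simp only [if_true]
    constructor
    · nlinarith
    · have := hx.2
      nlinarith

theorem iter_mem {p0 p1 c : ℝ} (h0 : 1 < p0) (h1 : 1 < p1) {R : ℝ → Bool} (hR : RuleOK c R)
    (hc : c ∈ Set.Icc (1 / p1) (Mx p1 / p0)) {x : ℝ} (hx : x ∈ Set.Icc 0 (Mx p1)) (n : ℕ) :
    (TT p0 p1 R)^[n] x ∈ Set.Icc 0 (Mx p1) := by
  induction n generalizing x with
  | zero => exact hx
  | succ n ih => rw [Function.iterate_succ_apply]; exact ih (TT_mem h0 h1 hR hc hx)

theorem piE_itin {p0 p1 c : ℝ} (h0 : 1 < p0) (h1 : 1 < p1) {R : ℝ → Bool} (hR : RuleOK c R)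
    (hc : c ∈ Set.Icc (1 / p1) (Mx p1 / p0)) {x : ℝ} (hx : x ∈ Set.Icc 0 (Mx p1)) :
    piE p0 p1 (itin p0 p1 R x) = x := by
  have hl := lam_gt_one h0 h1
  set r := (lam p0 p1)⁻¹ with hr
  have hr0 : 0 < r := by positivity
  have hr1 : r < 1 := inv_lt_one_of_one_lt₀ hl
  have key : ∀ n : ℕ, ∀ x ∈ Set.Icc 0 (Mx p1),
      |piE p0 p1 (itin p0 p1 R x) - x| ≤ r ^ n * Mx p1 := by
    intro n
    induction n with
    | zero =>
      intro x hx
      have h2 := piE_nonneg h0 h1 (itin p0 p1 R x)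
      have h3 := piE_le h0 h1 (itin p0 p1 R x)
      rw [abs_le]
      constructor <;> linarith [hx.1, hx.2]
    | succ n ih =>
      intro x hx
      have h2 := ih _ (TT_mem h0 h1 hR hc hx)
      have h3 : shiftTail (itin p0 p1 R x) 1 = itin p0 p1 R (TT p0 p1 R x) :=
        shiftTail_itin p0 p1 R x 1
      have hq := qb_pos h0 h1 (R x)
      have h4 : piE p0 p1 (itin p0 p1 R x) - x =
          (piE p0 p1 (itin p0 p1 R (TT p0 p1 R x)) - TT p0 p1 R x) / qb p0 p1 (R x) := by
        have h5 := piE_rec h0 h1 (itin p0 p1 R x)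
        rw [h3, show itin p0 p1 R x 0 = R x from rfl] at h5
        rw [h5, eq_div_iff hq.ne', sub_mul, div_mul_cancel₀ _ hq.ne']
        unfold TT
        cases R x <;> simp [dv, qb] <;> ring
      rw [h4, abs_div, abs_of_pos hq, div_eq_mul_inv, pow_succ, mul_right_comm]
      have h6 : (qb p0 p1 (R x))⁻¹ ≤ r := inv_anti₀ (by positivity) (lam_le_qb _ _ _)
      exact mul_le_mul h2 h6 (inv_nonneg.2 hq.le) ((abs_nonneg _).trans h2)
  have ht : Tendsto (fun n : ℕ => r ^ n * Mx p1) atTop (𝓝 (0 * Mx p1)) :=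
    (tendsto_pow_atTop_nhds_zero_of_lt_one hr0.le hr1).mul_const _
  rw [zero_mul] at ht
  have := ge_of_tendsto' ht fun n => key n x hx
  exact sub_eq_zero.1 (abs_nonpos_iff.1 this)

theorem itin_mem_XX {p0 p1 c : ℝ} (h0 : 1 < p0) (h1 : 1 < p1) {R : ℝ → Bool} (hR : RuleOK c R)
    (hc : c ∈ Set.Icc (1 / p1) (Mx p1 / p0)) {x : ℝ} (hx : x ∈ Set.Icc 0 (Mx p1)) :
    itin p0 p1 R x ∈ XX p0 p1 c := by
  intro n
  rw [shiftTail_itin, piE_itin h0 h1 hR hc (iter_mem h0 h1 hR hc hx n)]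
  exact hR _

/-- Rule choosing the digit 0 at the threshold. -/
noncomputable def Rm (c : ℝ) : ℝ → Bool := fun y => decide (c < y)

/-- Rule choosing the digit 1 at the threshold. -/
noncomputable def Rp (c : ℝ) : ℝ → Bool := fun y => decide (c ≤ y)

theorem Rm_ok (c : ℝ) : RuleOK c (Rm c) := by
  intro y
  simp only [Rm, decide_eq_false_iff_not, not_lt, decide_eq_true_eq]
  exact ⟨id, le_of_lt⟩

theorem Rp_ok (c : ℝ) : RuleOK c (Rp c) := by
  intro y
  simp only [Rp, decide_eq_false_iff_not, not_le, decide_eq_true_eq]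
  exact ⟨le_of_lt, id⟩

/-- The lower condition: the subshift contains a full threshold system. -/
def LL (p0 p1 : ℝ) (a b : ℕ → Bool) : Prop :=
  ∃ c ∈ Set.Icc (1 / p1) (Mx p1 / p0),
    lexLe (itin p0 p1 (Rm c) c) a ∧ lexLe b (itin p0 p1 (Rp c) c)

theorem cI_mem {p0 p1 c : ℝ} (h0 : 1 < p0) (h1 : 1 < p1)
    (hc : c ∈ Set.Icc (1 / p1) (Mx p1 / p0)) : c ∈ Set.Icc 0 (Mx p1) := by
  have hM := Mx_pos h1
  refine ⟨(by positivity : (0:ℝ) ≤ 1 / p1).trans hc.1, hc.2.trans (div_le_self hM.le h0.le)⟩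

theorem LL_image {p0 p1 : ℝ} (h0 : 1 < p0) (h1 : 1 < p1) {a b : ℕ → Bool} (h : LL p0 p1 a b) :
    Set.Icc 0 (Mx p1) ⊆ piE p0 p1 '' Omega a b := by
  obtain ⟨c, hc, hac, hbc⟩ := h
  have hcM := cI_mem h0 h1 hc
  intro x hx
  refine ⟨itin p0 p1 (Rp c) x, ?_, piE_itin h0 h1 (Rp_ok c) hc hx⟩
  refine mem_Omega_of (fun n hn => ?_) (fun n hn => ?_)
  · refine lexLe_trans (Or.inl ?_) hac
    have hm := iter_mem h0 h1 (Rp_ok c) hc hx n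
    rw [shiftTail_itin]
    refine XX_lt h0 h1 (itin_mem_XX h0 h1 (Rp_ok c) hc hm) (itin_mem_XX h0 h1 (Rm_ok c) hc hcM) ?_
    rw [piE_itin h0 h1 (Rp_ok c) hc hm, piE_itin h0 h1 (Rm_ok c) hc hcM]
    simpa [itin, Rp] using hn
  · refine lexLe_trans hbc ?_
    have hm := iter_mem h0 h1 (Rp_ok c) hc hx n
    rw [shiftTail_itin]
    have hle : c ≤ (TT p0 p1 (Rp c))^[n] x := by simpa [itin, Rp] using hn
    rcases hle.lt_or_eq with h | h
    · left
      refine XX_lt h0 h1 (itin_mem_XX h0 h1 (Rp_ok c) hc hcM)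
        (itin_mem_XX h0 h1 (Rp_ok c) hc hm) ?_
      rw [piE_itin h0 h1 (Rp_ok c) hc hm, piE_itin h0 h1 (Rp_ok c) hc hcM]
      exact h
    · right
      rw [← h]

/-- The gap condition. -/
def Gap (p0 p1 : ℝ) (a b : ℕ → Bool) : Prop :=
  ∀ u ∈ Omega a b, ∀ v ∈ Omega a b, u 0 = false → v 0 = true → piE p0 p1 u < piE p0 p1 v

theorem XX_eq_val {p0 p1 : ℝ} (h0 : 1 < p0) (h1 : 1 < p1) {n : ℕ} {x y : ℕ → Bool}
    (h : ∀ m, m < n → x m = y m) (hv : piE p0 p1 x = piE p0 p1 y) :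
    piE p0 p1 (shiftTail x n) = piE p0 p1 (shiftTail y n) := by
  have h2 := piE_sub h0 h1 h
  rw [hv, sub_self] at h2
  rcases mul_eq_zero.1 h2.symm with h3 | h3
  · exact absurd h3 (wt_pos h0 h1 _).ne'
  · linarith

theorem itin_Rm_le {p0 p1 c : ℝ} (h0 : 1 < p0) (h1 : 1 < p1)
    (hc : c ∈ Set.Icc (1 / p1) (Mx p1 / p0)) {u : ℕ → Bool} (hu : u ∈ XX p0 p1 c)
    (huc : piE p0 p1 u = c) : lexLe (itin p0 p1 (Rm c) c) u := by
  have hcM := cI_mem h0 h1 hc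
  refine not_lexLt.1 ?_
  rintro ⟨n, hn, hlt⟩
  obtain ⟨hf, ht⟩ := bool_lt_iff.1 hlt
  have h2 := XX_eq_val h0 h1 hn (huc.trans (piE_itin h0 h1 (Rm_ok c) hc hcM).symm)
  rw [shiftTail_itin, piE_itin h0 h1 (Rm_ok c) hc (iter_mem h0 h1 (Rm_ok c) hc hcM n)] at h2
  have h3 := (hu n).1 hf
  have h4 : c < (TT p0 p1 (Rm c))^[n] c := by simpa [itin, Rm] using ht
  linarith

theorem le_itin_Rp {p0 p1 c : ℝ} (h0 : 1 < p0) (h1 : 1 < p1)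
    (hc : c ∈ Set.Icc (1 / p1) (Mx p1 / p0)) {u : ℕ → Bool} (hu : u ∈ XX p0 p1 c)
    (huc : piE p0 p1 u = c) : lexLe u (itin p0 p1 (Rp c) c) := by
  have hcM := cI_mem h0 h1 hc
  refine not_lexLt.1 ?_
  rintro ⟨n, hn, hlt⟩
  obtain ⟨hf, ht⟩ := bool_lt_iff.1 hlt
  have h2 := XX_eq_val h0 h1 hn ((piE_itin h0 h1 (Rp_ok c) hc hcM).trans huc.symm)
  rw [shiftTail_itin, piE_itin h0 h1 (Rp_ok c) hc (iter_mem h0 h1 (Rp_ok c) hc hcM n)] at h2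
  have h3 := (hu n).2 ht
  have h4 : (TT p0 p1 (Rp c))^[n] c < c := by simpa [itin, Rp] using hf
  linarith

theorem UU_of_not_LL {p0 p1 : ℝ} (h0 : 1 < p0) (h1 : 1 < p1) {a b : ℕ → Bool}
    (ha : a 0 = false) (hb : b 0 = true)
    (hI : 1 / p1 ≤ Mx p1 / p0) (h : ¬ LL p0 p1 a b) : UU p0 p1 a b := by
  set I := Set.Icc (1 / p1) (Mx p1 / p0) with hIdef
  have hIc : IsCompact I := isCompact_Icc
  have hX := isClosed_XX h0 h1
  have hd : ∀ d : Bool, IsClosed {p : ℝ × (ℕ → Bool) | p.2 0 = d} := fun d =>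
    (isClosed_discrete {d}).preimage
      ((continuous_apply 0).comp continuous_snd : Continuous fun p : ℝ × (ℕ → Bool) => p.2 0)
  have hcp : IsCompact (I ×ˢ (Set.univ : Set (ℕ → Bool))) := hIc.prod isCompact_univ
  let P : Set ℝ := Prod.fst '' ((I ×ˢ (Set.univ : Set (ℕ → Bool))) ∩
    ({p | p.2 ∈ XX p0 p1 p.1} ∩ ({p | p.2 0 = false} ∩ {p | lexLe a p.2})))
  let N : Set ℝ := Prod.fst '' ((I ×ˢ (Set.univ : Set (ℕ → Bool))) ∩
    ({p | p.2 ∈ XX p0 p1 p.1} ∩ ({p | p.2 0 = true} ∩ {p | lexLe p.2 b})))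
  have hP : IsClosed P := by
    refine ((hcp.inter_right (hX.inter ((hd false).inter ?_))).image continuous_fst).isClosed
    exact isClosed_lexLe.preimage (f := fun p : ℝ × (ℕ → Bool) => (a, p.2)) (by fun_prop)
  have hN : IsClosed N := by
    refine ((hcp.inter_right (hX.inter ((hd true).inter ?_))).image continuous_fst).isClosed
    exact isClosed_lexLe.preimage (f := fun p : ℝ × (ℕ → Bool) => (p.2, b)) (by fun_prop)
  have hcov : I ⊆ P ∪ N := by
    intro c hc
    have hcM := cI_mem h0 h1 hc
    by_cases h2 : lexLe (itin p0 p1 (Rm c) c) a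
    · right
      have h3 : ¬ lexLe b (itin p0 p1 (Rp c) c) := fun h3 => h ⟨c, hc, h2, h3⟩
      refine ⟨(c, itin p0 p1 (Rp c) c), ⟨⟨hc, Set.mem_univ _⟩,
        itin_mem_XX h0 h1 (Rp_ok c) hc hcM, ?_, ?_⟩, rfl⟩
      · show itin p0 p1 (Rp c) c 0 = true
        simp [itin, Rp]
      · rw [← not_lexLt, not_not] at h3
        exact Or.inl h3
    · left
      refine ⟨(c, itin p0 p1 (Rm c) c), ⟨⟨hc, Set.mem_univ _⟩,
        itin_mem_XX h0 h1 (Rm_ok c) hc hcM, ?_, ?_⟩, rfl⟩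
      · show itin p0 p1 (Rm c) c 0 = false
        simp [itin, Rm]
      · rw [← not_lexLt, not_not] at h2
        exact Or.inl h2
  have hPne : (I ∩ P).Nonempty := by
    refine ⟨Mx p1 / p0, ⟨hI, le_rfl⟩, (Mx p1 / p0, scons false fun _ => true),
      ⟨⟨⟨hI, le_rfl⟩, Set.mem_univ _⟩, ?_, rfl, ?_⟩, rfl⟩
    · intro n
      cases n with
      | zero =>
        refine ⟨fun _ => piE_false_le h0 h1 rfl, fun h => absurd h (by simp [scons])⟩
      | succ n =>
        refine ⟨fun h => absurd h (by simp [scons]), fun _ => ?_⟩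
        rw [shiftTail_scons_succ]
        show _ ≤ piE p0 p1 (fun _ => true)
        rw [piE_constTrue h0 h1]
        exact div_le_self (Mx_pos h1).le h0.le
    · refine not_lexLt.1 ?_
      rintro ⟨n, -, hlt⟩
      obtain ⟨hf, ht⟩ := bool_lt_iff.1 hlt
      cases n with
      | zero => rw [ha] at ht; exact absurd ht (by decide)
      | succ n => simp [scons] at hf
  have hNne : (I ∩ N).Nonempty := by
    refine ⟨1 / p1, ⟨le_rfl, hI⟩, (1 / p1, scons true fun _ => false),
      ⟨⟨⟨le_rfl, hI⟩, Set.mem_univ _⟩, ?_, rfl, ?_⟩, rfl⟩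
    · intro n
      cases n with
      | zero =>
        refine ⟨fun h => absurd h (by simp [scons]), fun _ => piE_true_ge h0 h1 rfl⟩
      | succ n =>
        refine ⟨fun _ => ?_, fun h => absurd h (by simp [scons])⟩
        rw [shiftTail_scons_succ]
        show piE p0 p1 (fun _ => false) ≤ _
        rw [piE_constFalse h0 h1]
        positivity
    · refine not_lexLt.1 ?_
      rintro ⟨n, -, hlt⟩
      obtain ⟨hf, ht⟩ := bool_lt_iff.1 hlt
      cases n with
      | zero => rw [hb] at hf; exact absurd hf (by decide)
      | succ n => simp [scons] at ht
  obtain ⟨c, hc, ⟨⟨c1, a'⟩, ⟨-, ha1, ha2, ha3⟩, e1⟩, ⟨⟨c2, b'⟩, ⟨-, hb1, hb2, hb3⟩, e2⟩⟩ :=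
    isPreconnected_closed_iff.1 isPreconnected_Icc P N hP hN hcov hPne hNne
  simp only at e1 e2
  subst e1 e2
  exact ⟨c2, hc, a', ha1, b', hb1, ha2, hb2, ha3, hb3⟩

theorem LL_or_Gap {p0 p1 : ℝ} (h0 : 1 < p0) (h1 : 1 < p1) {a b : ℕ → Bool}
    (ha : a 0 = false) (hb : b 0 = true) : LL p0 p1 a b ∨ Gap p0 p1 a b := by
  by_cases hL : LL p0 p1 a b
  · exact Or.inl hL
  right
  intro u hu v hv hu0 hv0
  by_contra hlt
  push Not at hlt
  have hu1 := piE_false_le h0 h1 hu0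
  have hv1 := piE_true_ge h0 h1 hv0
  obtain ⟨c, hc, a', ha', b', hb', ha0, hb0, haa, hbb⟩ :=
    UU_of_not_LL h0 h1 ha hb (by linarith) hL
  have hsub := Omega_subset_XX h0 h1 ha hb ha' hb' ha0 hb0 haa hbb
  have h2 : piE p0 p1 u ≤ c := by simpa [shiftTail_zero] using (hsub hu 0).1 hu0
  have h3 : c ≤ piE p0 p1 v := by simpa [shiftTail_zero] using (hsub hv 0).2 hv0
  refine hL ⟨c, hc, ?_, ?_⟩
  · exact lexLe_trans (itin_Rm_le h0 h1 hc (hsub hu) (by linarith)) (Omega_le hb hu hu0)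
  · exact lexLe_trans (Omega_ge ha hv hv0) (le_itin_Rp h0 h1 hc (hsub hv) (by linarith))

theorem UU_closed {p0 p1 : ℝ} (h0 : 1 < p0) (h1 : 1 < p1) :
    IsClosed {p : (ℕ → Bool) × (ℕ → Bool) | UU p0 p1 p.1 p.2} := by
  let S := ℕ → Bool
  have hX := isClosed_XX h0 h1
  let A : Set (ℝ × (S × S) × (S × S)) :=
    (Set.Icc (1 / p1) (Mx p1 / p0) ×ˢ Set.univ) ∩
      ({z | z.2.1.1 ∈ XX p0 p1 z.1} ∩ {z | z.2.1.2 ∈ XX p0 p1 z.1} ∩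
      {z | z.2.1.1 0 = false} ∩ {z | z.2.1.2 0 = true} ∩
      {z | lexLe z.2.2.1 z.2.1.1} ∩ {z | lexLe z.2.1.2 z.2.2.2})
  have hA : IsCompact A := by
    refine IsCompact.inter_right (isCompact_Icc.prod isCompact_univ) ?_
    refine IsClosed.inter (IsClosed.inter (IsClosed.inter (IsClosed.inter (IsClosed.inter
      ?_ ?_) ?_) ?_) ?_) ?_
    · exact hX.preimage (f := fun z : ℝ × (S × S) × (S × S) => (z.1, z.2.1.1)) (by fun_prop)
    · exact hX.preimage (f := fun z : ℝ × (S × S) × (S × S) => (z.1, z.2.1.2)) (by fun_prop)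
    · exact (isClosed_discrete {false}).preimage
        (f := fun z : ℝ × (S × S) × (S × S) => z.2.1.1 0) (by fun_prop)
    · exact (isClosed_discrete {true}).preimage
        (f := fun z : ℝ × (S × S) × (S × S) => z.2.1.2 0) (by fun_prop)
    · exact isClosed_lexLe.preimage
        (f := fun z : ℝ × (S × S) × (S × S) => (z.2.2.1, z.2.1.1)) (by fun_prop)
    · exact isClosed_lexLe.preimage
        (f := fun z : ℝ × (S × S) × (S × S) => (z.2.1.2, z.2.2.2)) (by fun_prop)
  have : {p : S × S | UU p0 p1 p.1 p.2} = (fun z : ℝ × (S × S) × (S × S) => z.2.2) '' A := by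
    ext ⟨a, b⟩
    constructor
    · rintro ⟨c, hc, a', ha', b', hb', ha0, hb0, haa, hbb⟩
      exact ⟨(c, (a', b'), (a, b)), ⟨⟨hc, Set.mem_univ _⟩, ⟨⟨⟨⟨⟨ha', hb'⟩, ha0⟩, hb0⟩, haa⟩, hbb⟩⟩,
        rfl⟩
    · rintro ⟨⟨c, ⟨a', b'⟩, ⟨a1, b1⟩⟩, ⟨⟨hc, -⟩, ⟨⟨⟨⟨⟨ha', hb'⟩, ha0⟩, hb0⟩, haa⟩, hbb⟩⟩, e⟩
      simp only [Prod.mk.injEq] at e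
      obtain ⟨rfl, rfl⟩ := e
      exact ⟨c, hc, a', ha', b', hb', ha0, hb0, haa, hbb⟩
  rw [this]
  exact (hA.image (by fun_prop)).isClosed

/-- A failing gap is a closed condition. -/
theorem Gap_compl_closed {p0 p1 : ℝ} (h0 : 1 < p0) (h1 : 1 < p1) :
    IsOpen {p : (ℕ → Bool) × (ℕ → Bool) | Gap p0 p1 p.1 p.2} := by
  let S := ℕ → Bool
  have hcont := piE_continuous h0 h1
  let A : Set ((S × S) × (S × S)) :=
      ({z | z.1.1 ∈ Omega z.2.1 z.2.2} ∩ {z | z.1.2 ∈ Omega z.2.1 z.2.2} ∩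
      {z | z.1.1 0 = false} ∩ {z | z.1.2 0 = true} ∩
      {z | piE p0 p1 z.1.2 ≤ piE p0 p1 z.1.1})
  have hA : IsCompact A := by
    refine IsClosed.isCompact ?_
    refine IsClosed.inter (IsClosed.inter (IsClosed.inter (IsClosed.inter ?_ ?_) ?_) ?_) ?_
    · exact isClosed_Omega.preimage (f := fun z : (S × S) × (S × S) => (z.2, z.1.1)) (by fun_prop)
    · exact isClosed_Omega.preimage (f := fun z : (S × S) × (S × S) => (z.2, z.1.2)) (by fun_prop)
    · exact (isClosed_discrete {false}).preimage
        (f := fun z : (S × S) × (S × S) => z.1.1 0) (by fun_prop)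
    · exact (isClosed_discrete {true}).preimage
        (f := fun z : (S × S) × (S × S) => z.1.2 0) (by fun_prop)
    · exact isClosed_le (by fun_prop) (by fun_prop)
  have : {p : S × S | Gap p0 p1 p.1 p.2} = ((fun z : (S × S) × (S × S) => z.2) '' A)ᶜ := by
    ext ⟨a, b⟩
    constructor
    · rintro h ⟨⟨⟨u, v⟩, ⟨a1, b1⟩⟩, ⟨⟨⟨⟨hu, hv⟩, hu0⟩, hv0⟩, hle⟩, e⟩
      simp only [Prod.mk.injEq] at e
      obtain ⟨rfl, rfl⟩ := e
      exact absurd (h u hu v hv hu0 hv0) (not_lt.2 hle)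
    · intro h u hu v hv hu0 hv0
      by_contra hc
      exact h ⟨((u, v), (a, b)), ⟨⟨⟨⟨hu, hv⟩, hu0⟩, hv0⟩, not_lt.1 hc⟩, rfl⟩
  rw [this]
  exact (hA.image (by fun_prop)).isClosed.isOpen_compl

theorem Gap_unif {p0 p1 : ℝ} (h0 : 1 < p0) (h1 : 1 < p1) {a b : ℕ → Bool} (h : Gap p0 p1 a b) :
    ∃ ε > 0, ∀ u ∈ Omega a b, ∀ v ∈ Omega a b, u 0 = false → v 0 = true →
      ε ≤ piE p0 p1 v - piE p0 p1 u := by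
  have hcont := piE_continuous h0 h1
  let A : Set ((ℕ → Bool) × (ℕ → Bool)) :=
    ((Omega a b) ×ˢ (Omega a b)) ∩ ({z | z.1 0 = false} ∩ {z | z.2 0 = true})
  have hA : IsCompact A := by
    refine IsClosed.isCompact ?_
    refine IsClosed.inter ((isClosed_Omega' a b).prod (isClosed_Omega' a b)) (IsClosed.inter ?_ ?_)
    · exact (isClosed_discrete {false}).preimage
        (f := fun z : (ℕ → Bool) × (ℕ → Bool) => z.1 0) (by fun_prop)
    · exact (isClosed_discrete {true}).preimage
        (f := fun z : (ℕ → Bool) × (ℕ → Bool) => z.2 0) (by fun_prop)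
  rcases A.eq_empty_or_nonempty with hE | hne
  · refine ⟨1, one_pos, fun u hu v hv hu0 hv0 => ?_⟩
    have : (u, v) ∈ A := ⟨⟨hu, hv⟩, hu0, hv0⟩
    rw [hE] at this
    exact absurd this (Set.notMem_empty _)
  · obtain ⟨⟨u, v⟩, ⟨⟨hu, hv⟩, hu0, hv0⟩, hmin⟩ := hA.exists_isMinOn hne
      (f := fun z => piE p0 p1 z.2 - piE p0 p1 z.1) (by fun_prop)
    refine ⟨piE p0 p1 v - piE p0 p1 u, sub_pos.2 (h u hu v hv hu0 hv0),
      fun u' hu' v' hv' hu0' hv0' => ?_⟩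
    exact hmin (show (u', v') ∈ A from ⟨⟨hu', hv'⟩, hu0', hv0'⟩)

theorem rpow_gt_one {p r : ℝ} (h : 1 < p) (hr : 0 < r) : 1 < p ^ r := Real.one_lt_rpow h hr

theorem wt_rpow {p0 p1 : ℝ} (h0 : 1 < p0) (h1 : 1 < p1) (r : ℝ) (w : List Bool) :
    wt (p0 ^ r) (p1 ^ r) w = (wt p0 p1 w) ^ r := by
  induction w with
  | nil => simp [wt]
  | cons d w ih =>
    simp only [wt, ih]
    rw [Real.div_rpow (wt_pos h0 h1 w).le (qb_pos h0 h1 d).le]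
    cases d <;> simp [qb]

/-- Under the gap condition the change of exponent is Hoelder. -/
theorem Gap_holder {p0 p1 r : ℝ} (h0 : 1 < p0) (h1 : 1 < p1) (hr : 0 < r) {a b : ℕ → Bool}
    (h : Gap p0 p1 a b) : ∃ C : ℝ, 0 ≤ C ∧ ∀ x ∈ Omega a b, ∀ y ∈ Omega a b,
      |piE (p0 ^ r) (p1 ^ r) x - piE (p0 ^ r) (p1 ^ r) y| ≤
        C * |piE p0 p1 x - piE p0 p1 y| ^ r := by
  obtain ⟨ε, hε, hgap⟩ := Gap_unif h0 h1 h
  have h0' := rpow_gt_one h0 hr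
  have h1' := rpow_gt_one h1 hr
  have hM := Mx_pos h1'
  have hεr : 0 < ε ^ r := Real.rpow_pos_of_pos hε r
  refine ⟨Mx (p1 ^ r) / ε ^ r, by positivity, ?_⟩
  have key : ∀ x ∈ Omega a b, ∀ y ∈ Omega a b, lexLt x y →
      |piE (p0 ^ r) (p1 ^ r) x - piE (p0 ^ r) (p1 ^ r) y| ≤
        Mx (p1 ^ r) / ε ^ r * |piE p0 p1 x - piE p0 p1 y| ^ r := by
    rintro x hx y hy ⟨n, hn, hlt⟩
    obtain ⟨hf, ht⟩ := bool_lt_iff.1 hlt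
    have e1 := piE_sub h0' h1' hn
    have e2 := piE_sub h0 h1 hn
    have g := hgap _ (Omega_shift hx n) _ (Omega_shift hy n) (by simpa [shiftTail] using hf)
      (by simpa [shiftTail] using ht)
    have hw := wt_pos h0 h1 (pre n x)
    rw [abs_sub_comm, e1, abs_sub_comm (piE p0 p1 x), e2, wt_rpow h0 h1, abs_mul, abs_mul,
      abs_of_pos hw, abs_of_pos (Real.rpow_pos_of_pos hw r),
      Real.mul_rpow hw.le (abs_nonneg _)]
    have b1 : |piE (p0 ^ r) (p1 ^ r) (shiftTail y n) - piE (p0 ^ r) (p1 ^ r) (shiftTail x n)|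
        ≤ Mx (p1 ^ r) := by
      rw [abs_le]
      constructor <;> linarith [piE_le h0' h1' (shiftTail y n), piE_le h0' h1' (shiftTail x n),
        piE_nonneg h0' h1' (shiftTail y n), piE_nonneg h0' h1' (shiftTail x n)]
    have b2 : ε ^ r ≤ |piE p0 p1 (shiftTail y n) - piE p0 p1 (shiftTail x n)| ^ r :=
      Real.rpow_le_rpow hε.le (g.trans (le_abs_self _)) hr.le
    have hwr := Real.rpow_pos_of_pos hw r
    calc _ ≤ wt p0 p1 (pre n x) ^ r * Mx (p1 ^ r) := by gcongr
      _ = Mx (p1 ^ r) / ε ^ r * (wt p0 p1 (pre n x) ^ r * ε ^ r) := by field_simp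
      _ ≤ _ := by gcongr
  intro x hx y hy
  rcases lex_trichotomy x y with h2 | h2 | h2
  · exact key x hx y hy h2
  · subst h2; simp [Real.zero_rpow hr.ne']
  · rw [abs_sub_comm, abs_sub_comm (piE p0 p1 x)]; exact key y hy x hx h2

theorem Gap_dim {p0 p1 r : ℝ} (h0 : 1 < p0) (h1 : 1 < p1) (hr : 0 < r) {a b : ℕ → Bool}
    (h : Gap p0 p1 a b) : dimH (piE (p0 ^ r) (p1 ^ r) '' Omega a b) ≤
      dimH (piE p0 p1 '' Omega a b) / (Real.toNNReal r : NNReal) := by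
  obtain ⟨C, hC, hh⟩ := Gap_holder h0 h1 hr h
  let g := Function.invFunOn (piE p0 p1) (Omega a b)
  have hg : ∀ z ∈ piE p0 p1 '' Omega a b, g z ∈ Omega a b ∧ piE p0 p1 (g z) = z := fun z hz =>
    ⟨Function.invFunOn_mem hz, Function.invFunOn_eq hz⟩
  let f : ℝ → ℝ := fun z => piE (p0 ^ r) (p1 ^ r) (g z)
  have himg : piE (p0 ^ r) (p1 ^ r) '' Omega a b ⊆ f '' (piE p0 p1 '' Omega a b) := by
    rintro _ ⟨x, hx, rfl⟩
    refine ⟨piE p0 p1 x, ⟨x, hx, rfl⟩, ?_⟩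
    obtain ⟨k1, k2⟩ := hg _ ⟨x, hx, rfl⟩
    have := hh _ k1 x hx
    rw [k2, sub_self, abs_zero, Real.zero_rpow hr.ne', mul_zero] at this
    exact sub_eq_zero.1 (abs_nonpos_iff.1 this)
  refine (dimH_mono himg).trans ?_
  refine HolderOnWith.dimH_image_le (C := Real.toNNReal C) ?_ (by simpa using hr)
  intro z hz z' hz'
  obtain ⟨k1, k2⟩ := hg _ hz
  obtain ⟨k3, k4⟩ := hg _ hz'
  have := hh _ k1 _ k3
  rw [k2, k4] at this
  rw [edist_dist, edist_dist, Real.coe_toNNReal _ hr.le,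
    ENNReal.ofReal_rpow_of_nonneg dist_nonneg hr.le]
  rw [show ((Real.toNNReal C : NNReal) : ENNReal) = ENNReal.ofReal C from rfl,
    ← ENNReal.ofReal_mul hC]
  exact ENNReal.ofReal_le_ofReal this

theorem dimH_le_one (s : Set ℝ) : dimH s ≤ 1 := by
  refine (dimH_mono (Set.subset_univ s)).trans ?_
  rw [Real.dimH_univ]

theorem L4 {q0 q1 t : ℝ} (h0 : 1 < q0) (h1 : 1 < q1) (ht : 0 < t) {a b : ℕ → Bool}
    (h : Gap (q0 ^ t) (q1 ^ t) a b) : dimH (piE q0 q1 '' Omega a b) ≤ ENNReal.ofReal t := by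
  have := Gap_dim (rpow_gt_one h0 ht) (rpow_gt_one h1 ht) (inv_pos.2 ht) h
  rw [← Real.rpow_mul (by linarith), ← Real.rpow_mul (by linarith), mul_inv_cancel₀ ht.ne',
    Real.rpow_one, Real.rpow_one] at this
  refine this.trans ?_
  have h2 : ((Real.toNNReal t⁻¹ : NNReal) : ENNReal) = (ENNReal.ofReal t)⁻¹ := by
    rw [← ENNReal.ofReal_inv_of_pos ht]; rfl
  rw [h2, div_eq_mul_inv, inv_inv]
  calc _ ≤ 1 * ENNReal.ofReal t := by gcongr; exact dimH_le_one _
    _ = _ := one_mul _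

theorem LL_dim {p0 p1 : ℝ} (h0 : 1 < p0) (h1 : 1 < p1) {a b : ℕ → Bool} (h : LL p0 p1 a b) :
    1 ≤ dimH (piE p0 p1 '' Omega a b) := by
  have h2 := dimH_mono (LL_image h0 h1 h)
  rw [Real.dimH_of_nonempty_interior] at h2
  · simpa using h2
  · rw [interior_Icc]; exact Set.nonempty_Ioo.2 (Mx_pos h1)

theorem L5 {q0 q1 t : ℝ} (h0 : 1 < q0) (h1 : 1 < q1) (ht : 0 < t) (ht1 : t ≤ 1) {a b : ℕ → Bool}
    (ha : a 0 = false) (hb : b 0 = true)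
    (h : LL (q0 ^ t) (q1 ^ t) a b) : ENNReal.ofReal t ≤ dimH (piE q0 q1 '' Omega a b) := by
  rcases LL_or_Gap h0 h1 ha hb with h2 | h2
  · refine le_trans ?_ (LL_dim h0 h1 h2)
    rw [← ENNReal.ofReal_one]
    exact ENNReal.ofReal_le_ofReal ht1
  · have := (LL_dim (rpow_gt_one h0 ht) (rpow_gt_one h1 ht) h).trans (Gap_dim h0 h1 ht h2)
    have h3 : ENNReal.ofReal t ≠ 0 := by simpa using ht
    rw [show ((Real.toNNReal t : NNReal) : ENNReal) = ENNReal.ofReal t from rfl,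
      ENNReal.le_div_iff_mul_le (Or.inl h3) (Or.inl ENNReal.ofReal_ne_top), one_mul] at this
    exact this

/-- No point returns to itself through both digits. -/
def Good (p0 p1 : ℝ) : Prop := ∀ (v0 v1 : List Bool) (c : ℝ),
  ¬ (off p0 p1 (false :: v0) + wt p0 p1 (false :: v0) * c = c ∧
     off p0 p1 (true :: v1) + wt p0 p1 (true :: v1) * c = c)

theorem rpow_analytic {q : ℝ} (h : 1 < q) (x : ℝ) : AnalyticAt ℝ (fun t : ℝ => q ^ t) x := by
  have : (fun t : ℝ => q ^ t) = fun t : ℝ => Real.exp (Real.log q * t) := by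
    funext t; rw [Real.rpow_def_of_pos (by linarith)]
  rw [this]
  exact AnalyticAt.rexp' (by fun_prop)

theorem qb_analytic {q0 q1 : ℝ} (h0 : 1 < q0) (h1 : 1 < q1) (d : Bool) (x : ℝ) :
    AnalyticAt ℝ (fun t : ℝ => qb (q0 ^ t) (q1 ^ t) d) x := by
  cases d
  · simpa [qb] using rpow_analytic h0 x
  · simpa [qb] using rpow_analytic h1 x

theorem qb_rpow_ne {q0 q1 : ℝ} (h0 : 1 < q0) (h1 : 1 < q1) (d : Bool) (x : ℝ) :
    qb (q0 ^ x) (q1 ^ x) d ≠ 0 := by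
  cases d
  · simpa [qb] using (Real.rpow_pos_of_pos (by linarith : 0 < q0) x).ne'
  · simpa [qb] using (Real.rpow_pos_of_pos (by linarith : 0 < q1) x).ne'

theorem wt_analytic {q0 q1 : ℝ} (h0 : 1 < q0) (h1 : 1 < q1) (w : List Bool) (x : ℝ) :
    AnalyticAt ℝ (fun t : ℝ => wt (q0 ^ t) (q1 ^ t) w) x := by
  induction w with
  | nil => simp only [wt]; exact analyticAt_const
  | cons d w ih =>
    simp only [wt]
    exact ih.div (qb_analytic h0 h1 d x) (qb_rpow_ne h0 h1 d x)

theorem off_analytic {q0 q1 : ℝ} (h0 : 1 < q0) (h1 : 1 < q1) (w : List Bool) (x : ℝ) :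
    AnalyticAt ℝ (fun t : ℝ => off (q0 ^ t) (q1 ^ t) w) x := by
  induction w with
  | nil => simp only [off]; exact analyticAt_const
  | cons d w ih =>
    simp only [off]
    exact (analyticAt_const.add ih).div (qb_analytic h0 h1 d x) (qb_rpow_ne h0 h1 d x)

/-- The obstruction function. -/
noncomputable def GG (q0 q1 : ℝ) (v0 v1 : List Bool) (t : ℝ) : ℝ :=
  off (q0 ^ t) (q1 ^ t) (false :: v0) * (1 - wt (q0 ^ t) (q1 ^ t) (true :: v1)) -
  off (q0 ^ t) (q1 ^ t) (true :: v1) * (1 - wt (q0 ^ t) (q1 ^ t) (false :: v0))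

theorem GG_analytic {q0 q1 : ℝ} (h0 : 1 < q0) (h1 : 1 < q1) (v0 v1 : List Bool) (x : ℝ) :
    AnalyticAt ℝ (GG q0 q1 v0 v1) x := by
  unfold GG
  exact ((off_analytic h0 h1 _ x).mul (analyticAt_const.sub (wt_analytic h0 h1 _ x))).sub
    ((off_analytic h0 h1 _ x).mul (analyticAt_const.sub (wt_analytic h0 h1 _ x)))

theorem off_eq_piE {p0 p1 : ℝ} (h0 : 1 < p0) (h1 : 1 < p1) (w : List Bool) :
    off p0 p1 w = piE p0 p1 (cat w fun _ => false) := by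
  rw [piE_cat h0 h1, piE_constFalse h0 h1]; ring

theorem wt_le_one {p0 p1 : ℝ} (h0 : 1 < p0) (h1 : 1 < p1) (w : List Bool) :
    wt p0 p1 w ≤ 1 := by
  refine (wt_le h0 h1 w).trans (pow_le_one₀ ?_ ?_)
  · have := lam_gt_one h0 h1; positivity
  · exact inv_le_one_of_one_le₀ (lam_gt_one h0 h1).le

theorem G_neg {p0 p1 : ℝ} (h0 : 4 ≤ p0) (h1 : 4 ≤ p1) (v0 v1 : List Bool) :
    off p0 p1 (false :: v0) * (1 - wt p0 p1 (true :: v1)) -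
    off p0 p1 (true :: v1) * (1 - wt p0 p1 (false :: v0)) < 0 := by
  have g0 : 1 < p0 := by linarith
  have g1 : 1 < p1 := by linarith
  have o0 : off p0 p1 (false :: v0) ≤ Mx p1 / p0 := by
    rw [off_eq_piE g0 g1]; exact piE_false_le g0 g1 rfl
  have o0' : 0 ≤ off p0 p1 (false :: v0) := by
    rw [off_eq_piE g0 g1]; exact piE_nonneg g0 g1 _
  have o1 : 1 / p1 ≤ off p0 p1 (true :: v1) := by
    rw [off_eq_piE g0 g1]; exact piE_true_ge g0 g1 rfl
  have w1 := wt_pos g0 g1 (true :: v1)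
  have w0 : wt p0 p1 (false :: v0) ≤ 1 / 4 := by
    simp only [wt, qb]
    have := wt_le_one g0 g1 v0
    rw [div_le_iff₀ (by simp; linarith)]
    simp; linarith
  have hM : Mx p1 / p0 < 3 / 4 * (1 / p1) := by
    unfold Mx
    rw [div_div, mul_one_div, div_lt_div_iff₀ (by nlinarith) (by linarith)]
    nlinarith
  have e1 : off p0 p1 (false :: v0) * (1 - wt p0 p1 (true :: v1)) ≤ Mx p1 / p0 := by nlinarith
  have e2 : 3 / 4 * (1 / p1) ≤ off p0 p1 (true :: v1) * (1 - wt p0 p1 (false :: v0)) := by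
    have : 0 < 1 / p1 := by positivity
    nlinarith
  linarith

theorem exists_large {q : ℝ} (h : 1 < q) : ∀ᶠ t : ℝ in atTop, 4 ≤ q ^ t :=
  (tendsto_rpow_atTop_of_base_gt_one q h).eventually_ge_atTop 4

theorem GG_dense {q0 q1 : ℝ} (h0 : 1 < q0) (h1 : 1 < q1) (v0 v1 : List Bool) :
    IsOpen {t | GG q0 q1 v0 v1 t ≠ 0} ∧ Dense {t | GG q0 q1 v0 v1 t ≠ 0} := by
  have han : AnalyticOnNhd ℝ (GG q0 q1 v0 v1) Set.univ := fun x _ => GG_analytic h0 h1 v0 v1 x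
  have hc : Continuous (GG q0 q1 v0 v1) := continuous_iff_continuousAt.2 fun x =>
    (GG_analytic h0 h1 v0 v1 x).continuousAt
  refine ⟨isOpen_ne_fun hc continuous_const, ?_⟩
  rw [show {t | GG q0 q1 v0 v1 t ≠ 0} = {t | GG q0 q1 v0 v1 t = 0}ᶜ from rfl,
    ← interior_eq_empty_iff_dense_compl]
  by_contra hne
  obtain ⟨x, hx⟩ := Set.nonempty_iff_ne_empty.2 hne
  have hz := mem_interior_iff_mem_nhds.1 hx
  have := han.eqOn_zero_of_preconnected_of_eventuallyEq_zero isPreconnected_univ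
    (Set.mem_univ x) (Filter.mem_of_superset hz fun y hy => hy)
  obtain ⟨T, hT0, hT1⟩ := ((exists_large h0).and (exists_large h1)).exists
  have h3 := G_neg hT0 hT1 v0 v1
  have h4 : GG q0 q1 v0 v1 T = 0 := this (Set.mem_univ T)
  unfold GG at h4
  linarith

theorem Good_dense {q0 q1 : ℝ} (h0 : 1 < q0) (h1 : 1 < q1) :
    Dense {t : ℝ | Good (q0 ^ t) (q1 ^ t)} := by
  have hd : Dense (⋂ p : List Bool × List Bool, {t | GG q0 q1 p.1 p.2 t ≠ 0}) :=
    dense_iInter_of_isOpen (fun p => (GG_dense h0 h1 p.1 p.2).1)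
      (fun p => (GG_dense h0 h1 p.1 p.2).2)
  refine hd.mono ?_
  intro t ht v0 v1 c hc
  have h2 := Set.mem_iInter.1 ht (v0, v1)
  apply h2
  unfold GG
  obtain ⟨e0, e1⟩ := hc
  have f0 : off (q0 ^ t) (q1 ^ t) (false :: v0) = c * (1 - wt (q0 ^ t) (q1 ^ t) (false :: v0)) := by
    linarith
  have f1 : off (q0 ^ t) (q1 ^ t) (true :: v1) = c * (1 - wt (q0 ^ t) (q1 ^ t) (true :: v1)) := by
    linarith
  simp only [f0, f1]; ring

theorem exists_good {q0 q1 : ℝ} (h0 : 1 < q0) (h1 : 1 < q1) {u v : ℝ} (h : u < v) :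
    ∃ t, u < t ∧ t < v ∧ Good (q0 ^ t) (q1 ^ t) := by
  obtain ⟨t, ht, hg⟩ := (Good_dense h0 h1).exists_between h
  exact ⟨t, hg.1, hg.2, ht⟩

/-- Words read off from expansions of `x` in `XX c`. -/
def SS (p0 p1 c : ℝ) (K : ℕ) (x : ℝ) : Set (List Bool) :=
  {w | ∃ y ∈ XX p0 p1 c, piE p0 p1 y = x ∧ pre K y = w}

theorem finite_len (K : ℕ) (S : Set (List Bool)) (h : ∀ w ∈ S, w.length = K) : S.Finite :=
  (List.finite_length_eq Bool K).subset h

theorem SS_finite (p0 p1 c : ℝ) (K : ℕ) (x : ℝ) : (SS p0 p1 c K x).Finite := by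
  refine finite_len K _ ?_
  rintro w ⟨y, -, -, rfl⟩
  exact length_pre K y

theorem ret_unique {p0 p1 c : ℝ} (h0 : 1 < p0) (h1 : 1 < p1) {d : Bool}
    (hd : ∀ v, off p0 p1 (d :: v) + wt p0 p1 (d :: v) * c ≠ c) {y z : ℕ → Bool}
    (hy : y ∈ XX p0 p1 c) (hz : z ∈ XX p0 p1 c) (hyc : piE p0 p1 y = c) (hzc : piE p0 p1 z = c)
    (hyd : y 0 = d) (hzd : z 0 = d) : y = z := by
  have key : ∀ y z : ℕ → Bool, y ∈ XX p0 p1 c → z ∈ XX p0 p1 c → piE p0 p1 y = c →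
      piE p0 p1 z = c → y 0 = d → z 0 = d → ¬ lexLt y z := by
    rintro y z hy hz hyc hzc hyd hzd ⟨n, hn, hlt⟩
    obtain ⟨hf, ht⟩ := bool_lt_iff.1 hlt
    have e := XX_eq_val h0 h1 hn (hyc.trans hzc.symm)
    have k1 := (hy n).1 hf
    have k2 := (hz n).2 ht
    have hv : piE p0 p1 (shiftTail y n) = c := le_antisymm k1 (by rw [e]; exact k2)
    cases n with
    | zero => rw [hyd, hzd] at hlt; exact lt_irrefl _ hlt
    | succ n =>
      have := piE_pre h0 h1 (n + 1) y
      rw [hyc, hv] at this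
      simp only [pre, hyd] at this
      exact hd _ this.symm
  rcases lex_trichotomy y z with h | h | h
  · exact absurd h (key y z hy hz hyc hzc hyd hzd)
  · exact h
  · exact absurd h (key z y hz hy hzc hyc hzd hyd)

theorem SS_card {p0 p1 c : ℝ} (h0 : 1 < p0) (h1 : 1 < p1) {d : Bool}
    (hd : ∀ v, off p0 p1 (d :: v) + wt p0 p1 (d :: v) * c ≠ c) (K : ℕ) (x : ℝ) :
    (SS p0 p1 c K x).ncard ≤ K + 1 := by
  induction K generalizing x with
  | zero =>
    have : SS p0 p1 c 0 x ⊆ {[]} := by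
      rintro w ⟨y, -, -, rfl⟩; rfl
    exact (Set.ncard_le_ncard this).trans (by simp)
  | succ K ih =>
    have step : ∀ y ∈ XX p0 p1 c, piE p0 p1 y = x → ∀ e, y 0 = e →
        pre (K + 1) y ∈ (List.cons e) '' SS p0 p1 c K (qb p0 p1 e * x - dv e) := by
      intro y hy hyx e he
      refine ⟨pre K (shiftTail y 1), ⟨shiftTail y 1, XX_shift hy 1, ?_, rfl⟩, by simp [pre, he]⟩
      have := piE_rec h0 h1 y
      rw [eq_div_iff (qb_pos h0 h1 _).ne', he, hyx] at this
      linarith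
    have cardc : ∀ e, ((List.cons e) '' SS p0 p1 c K (qb p0 p1 e * x - dv e)).ncard ≤ K + 1 :=
      fun e => (Set.ncard_image_le (SS_finite p0 p1 c K _)).trans (ih _)
    have finc : ∀ e, ((List.cons e) '' SS p0 p1 c K (qb p0 p1 e * x - dv e)).Finite :=
      fun e => (SS_finite p0 p1 c K _).image _
    rcases lt_trichotomy x c with hx | hx | hx
    · have : SS p0 p1 c (K + 1) x ⊆
          (List.cons false) '' SS p0 p1 c K (qb p0 p1 false * x - dv false) := by
        rintro w ⟨y, hy, hyx, rfl⟩
        refine step y hy hyx false ?_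
        by_contra hne
        have := (hy 0).2 (by simpa using hne)
        rw [shiftTail_zero, hyx] at this
        linarith
      exact ((Set.ncard_le_ncard this (finc _)).trans (cardc _)).trans (by omega)
    · let T : Set (List Bool) := {w | ∃ y ∈ XX p0 p1 c, piE p0 p1 y = x ∧ y 0 = d ∧ pre (K+1) y = w}
      have hT : T.Subsingleton := by
        rintro w ⟨y, hy, hyx, hyd, rfl⟩ w' ⟨z, hz, hzx, hzd, rfl⟩
        rw [ret_unique h0 h1 hd hy hz (hyx.trans hx) (hzx.trans hx) hyd hzd]
      have : SS p0 p1 c (K + 1) x ⊆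
          T ∪ (List.cons (!d)) '' SS p0 p1 c K (qb p0 p1 (!d) * x - dv (!d)) := by
        rintro w ⟨y, hy, hyx, rfl⟩
        by_cases hyd : y 0 = d
        · exact Or.inl ⟨y, hy, hyx, hyd, rfl⟩
        · exact Or.inr (step y hy hyx (!d) (by cases h : y 0 <;> cases d <;> simp_all))
      have hT1 : T.ncard ≤ 1 := by
        haveI := hT.finite.to_subtype
        exact Set.ncard_le_one_iff_subsingleton.2 hT
      calc _ ≤ _ := Set.ncard_le_ncard this (hT.finite.union (finc _))
        _ ≤ _ := Set.ncard_union_le _ _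
        _ ≤ 1 + (K + 1) := add_le_add hT1 (cardc _)
        _ = _ := by ring
    · have : SS p0 p1 c (K + 1) x ⊆
          (List.cons true) '' SS p0 p1 c K (qb p0 p1 true * x - dv true) := by
        rintro w ⟨y, hy, hyx, rfl⟩
        refine step y hy hyx true ?_
        by_contra hne
        have := (hy 0).1 (by simpa using hne)
        rw [shiftTail_zero, hyx] at this
        linarith
      exact ((Set.ncard_le_ncard this (finc _)).trans (cardc _)).trans (by omega)

theorem isClosed_pre (K : ℕ) (S : Set (List Bool)) : IsClosed {y : ℕ → Bool | pre K y ∈ S} := by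
  have hc : Continuous (fun y : ℕ → Bool => fun m : Fin K => y m) := by fun_prop
  let T : Set (Fin K → Bool) := {f | ∃ y : ℕ → Bool, pre K y ∈ S ∧ (fun m : Fin K => y m) = f}
  have : {y : ℕ → Bool | pre K y ∈ S} = (fun y : ℕ → Bool => fun m : Fin K => y m) ⁻¹' T := by
    ext y
    constructor
    · intro h; exact ⟨y, h, rfl⟩
    · rintro ⟨z, hz, hzy⟩
      have : pre K z = pre K y := pre_congr fun m hm => congrFun hzy ⟨m, hm⟩
      simpa [this] using hz
  rw [this]
  exact (isClosed_discrete T).preimage hc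

theorem unif_card {p0 p1 c : ℝ} (h0 : 1 < p0) (h1 : 1 < p1) {d : Bool}
    (hd : ∀ v, off p0 p1 (d :: v) + wt p0 p1 (d :: v) * c ≠ c) (K : ℕ) :
    ∃ ε > 0, ∀ Y ⊆ XX p0 p1 c, (∀ y ∈ Y, ∀ z ∈ Y, |piE p0 p1 y - piE p0 p1 z| < ε) →
      (pre K '' Y).ncard ≤ K + 1 := by
  have hX := isClosed_XX' h0 h1 c
  let F : ℝ → Set ℝ := fun x => piE p0 p1 '' (XX p0 p1 c ∩ {y | pre K y ∈ (SS p0 p1 c K x)ᶜ})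
  have hF : ∀ x, IsClosed (F x) := fun x =>
    ((hX.inter (isClosed_pre K _)).isCompact.image (piE_continuous h0 h1)).isClosed
  have hxF : ∀ x, x ∉ F x := by
    rintro x ⟨y, ⟨hy, hny⟩, hyx⟩
    exact hny ⟨y, hy, hyx, rfl⟩
  obtain ⟨ε, hε, hl⟩ := lebesgue_number_lemma_of_metric (isCompact_Icc (a := 0) (b := Mx p1))
    (c := fun x : ℝ => (F x)ᶜ) (fun x => (hF x).isOpen_compl)
    (fun x _ => Set.mem_iUnion.2 ⟨x, hxF x⟩)
  refine ⟨ε, hε, fun Y hY hYd => ?_⟩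
  rcases Y.eq_empty_or_nonempty with h | ⟨z, hz⟩
  · simp [h]
  obtain ⟨x, hx⟩ := hl (piE p0 p1 z) ⟨piE_nonneg h0 h1 z, piE_le h0 h1 z⟩
  refine (Set.ncard_le_ncard ?_ (SS_finite p0 p1 c K x)).trans (SS_card h0 h1 hd K x)
  rintro w ⟨y, hy, rfl⟩
  by_contra hn
  exact hx (Metric.mem_ball.2 (hYd y hy z hz)) ⟨y, ⟨hY hy, hn⟩, rfl⟩

/-- All words of length `n`. -/
def WW : ℕ → Finset (List Bool)
  | 0 => {[]}
  | n + 1 => (WW n).image (List.cons false) ∪ (WW n).image (List.cons true)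

theorem mem_WW {n : ℕ} {w : List Bool} : w ∈ WW n ↔ w.length = n := by
  induction n generalizing w with
  | zero => simp [WW]
  | succ n ih =>
    cases w with
    | nil => simp [WW]
    | cons d w =>
      simp only [WW, Finset.mem_union, Finset.mem_image, List.cons.injEq, List.length_cons,
        add_left_inj, ih]
      cases d <;> simp

theorem sum_WW_succ (n : ℕ) (f : List Bool → ℝ) :
    ∑ w ∈ WW (n + 1), f w = ∑ w ∈ WW n, f (false :: w) + ∑ w ∈ WW n, f (true :: w) := by
  rw [WW, Finset.sum_union, Finset.sum_image, Finset.sum_image]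
  · intro x _ y _ h; simpa using h
  · intro x _ y _ h; simpa using h
  · rw [Finset.disjoint_left]
    intro w hw hw'
    simp only [Finset.mem_image] at hw hw'
    obtain ⟨u, -, rfl⟩ := hw
    obtain ⟨v, -, hv⟩ := hw'
    simp at hv

theorem sum_WW_add (m n : ℕ) (f : List Bool → ℝ) :
    ∑ w ∈ WW (m + n), f w = ∑ u ∈ WW m, ∑ v ∈ WW n, f (u ++ v) := by
  induction m generalizing f with
  | zero => simp [WW]
  | succ m ih =>
    rw [show m + 1 + n = (m + n) + 1 by ring, sum_WW_succ, sum_WW_succ, ih, ih]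
    simp

theorem card_WW (n : ℕ) : (WW n).card = 2 ^ n := by
  have : ∀ n, ∑ w ∈ WW n, (1 : ℝ) = 2 ^ n := by
    intro n
    induction n with
    | zero => simp [WW]
    | succ n ih => rw [sum_WW_succ, ih]; ring
  have h := this n
  rw [Finset.sum_const, nsmul_eq_mul, mul_one] at h
  exact_mod_cast h

/-- Cylinder sets. -/
def CC (p0 p1 c : ℝ) (w : List Bool) : Set (ℕ → Bool) :=
  {y | y ∈ XX p0 p1 c ∧ pre w.length y = w}

theorem piE_bdd {p0 p1 : ℝ} (h0 : 1 < p0) (h1 : 1 < p1) (S : Set (ℕ → Bool)) :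
    Bornology.IsBounded (piE p0 p1 '' S) :=
  (Metric.isBounded_Icc 0 (Mx p1)).subset (by
    rintro _ ⟨y, -, rfl⟩; exact ⟨piE_nonneg h0 h1 y, piE_le h0 h1 y⟩)

/-- The length of the image of a cylinder. -/
noncomputable def ee (p0 p1 c : ℝ) (w : List Bool) : ℝ :=
  Metric.diam (piE p0 p1 '' CC p0 p1 c w)

theorem CC_append_pre {p0 p1 c : ℝ} {u v : List Bool} {y : ℕ → Bool}
    (h : y ∈ CC p0 p1 c (u ++ v)) : y ∈ CC p0 p1 c u ∧ pre v.length (shiftTail y u.length) = v := by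
  obtain ⟨hy, hp⟩ := h
  rw [List.length_append, pre_add] at hp
  obtain ⟨k1, k2⟩ := List.append_inj hp (length_pre _ _)
  exact ⟨⟨hy, k1⟩, k2⟩

theorem diam_add_le {A B S : Set ℝ} (hS : Bornology.IsBounded S) (hA : A ⊆ S) (hB : B ⊆ S)
    (h : ∀ x ∈ A, ∀ y ∈ B, x ≤ y) : Metric.diam A + Metric.diam B ≤ Metric.diam S := by
  rcases A.eq_empty_or_nonempty with rfl | hAn
  · simpa using Metric.diam_mono hB hS
  rcases B.eq_empty_or_nonempty with rfl | hBn
  · simpa using Metric.diam_mono hA hS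
  rw [Real.diam_eq hS, Real.diam_eq (hS.subset hA), Real.diam_eq (hS.subset hB)]
  have k1 : sSup A ≤ sInf B := csSup_le hAn fun x hx => le_csInf hBn fun y hy => h x hx y hy
  have k2 : sInf S ≤ sInf A := csInf_le_csInf hS.bddBelow hAn hA
  have k3 : sSup B ≤ sSup S := csSup_le_csSup hS.bddAbove hBn hB
  linarith

theorem ee_add {p0 p1 : ℝ} (c : ℝ) (h0 : 1 < p0) (h1 : 1 < p1) (u : List Bool) :
    ee p0 p1 c (u ++ [false]) + ee p0 p1 c (u ++ [true]) ≤ ee p0 p1 c u := by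
  refine diam_add_le (piE_bdd h0 h1 _) (Set.image_mono fun y hy => (CC_append_pre hy).1)
    (Set.image_mono fun y hy => (CC_append_pre hy).1) ?_
  rintro _ ⟨y, hy, rfl⟩ _ ⟨z, hz, rfl⟩
  refine XX_mono h0 h1 hy.1 hz.1 ⟨u.length, ?_, ?_⟩
  · exact pre_inj ((CC_append_pre hy).1.2.trans (CC_append_pre hz).1.2.symm)
  · have k1 := (CC_append_pre hy).2
    have k2 := (CC_append_pre hz).2
    simp [pre, shiftTail] at k1 k2
    rw [k1, k2]; decide

theorem ee_sum {p0 p1 : ℝ} (c : ℝ) (h0 : 1 < p0) (h1 : 1 < p1) (n : ℕ) (u : List Bool) :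
    ∑ w ∈ WW n, ee p0 p1 c (u ++ w) ≤ ee p0 p1 c u := by
  induction n generalizing u with
  | zero => simp [WW]
  | succ n ih =>
    rw [sum_WW_succ]
    have k1 := ih (u ++ [false])
    have k2 := ih (u ++ [true])
    simp only [List.append_assoc, List.cons_append, List.nil_append] at k1 k2
    have := ee_add c h0 h1 u
    linarith

theorem ee_sum' {p0 p1 : ℝ} (c : ℝ) (h0 : 1 < p0) (h1 : 1 < p1) (n : ℕ) :
    ∑ w ∈ WW n, ee p0 p1 c w ≤ Mx p1 := by
  have := ee_sum c h0 h1 n []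
  simp only [List.nil_append] at this
  refine this.trans ?_
  refine Metric.diam_le_of_forall_dist_le (Mx_pos h1).le ?_
  rintro _ ⟨y, -, rfl⟩ _ ⟨z, -, rfl⟩
  rw [Real.dist_eq, abs_le]
  constructor <;> linarith [piE_nonneg h0 h1 y, piE_nonneg h0 h1 z, piE_le h0 h1 y, piE_le h0 h1 z]

open Classical in
/-- Weight of a nonempty cylinder. -/
noncomputable def zz (p0 p1 c : ℝ) (w : List Bool) : ℝ :=
  if (CC p0 p1 c w).Nonempty then wt p0 p1 w else 0

theorem zz_nonneg {p0 p1 : ℝ} (c : ℝ) (h0 : 1 < p0) (h1 : 1 < p1) (w : List Bool) :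
    0 ≤ zz p0 p1 c w := by
  unfold zz; split_ifs
  · exact (wt_pos h0 h1 w).le
  · exact le_rfl

theorem inner_bound {p0 p1 c : ℝ} (h0 : 1 < p0) (h1 : 1 < p1) {K : ℕ} {ε : ℝ} (hε : 0 < ε)
    (hY : ∀ Y ⊆ XX p0 p1 c, (∀ y ∈ Y, ∀ z ∈ Y, |piE p0 p1 y - piE p0 p1 z| < ε) →
      (pre K '' Y).ncard ≤ K + 1) (u : List Bool) :
    ∑ v ∈ WW K, zz p0 p1 c (u ++ v) ≤
      2 ^ K / ε * ee p0 p1 c u + (K + 1) * (lam p0 p1)⁻¹ ^ K * zz p0 p1 c u := by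
  classical
  have hl := lam_gt_one h0 h1
  have hwu := wt_pos h0 h1 u
  have hee : 0 ≤ ee p0 p1 c u := Metric.diam_nonneg
  have hzz := zz_nonneg c h0 h1 u
  by_cases hs : ee p0 p1 c u < ε * wt p0 p1 u
  · let Y : Set (ℕ → Bool) := (fun y => shiftTail y u.length) '' CC p0 p1 c u
    have hcard : (pre K '' Y).ncard ≤ K + 1 := by
      apply hY
      · rintro _ ⟨y, hy, rfl⟩; exact XX_shift hy.1 _
      · rintro _ ⟨y, hy, rfl⟩ _ ⟨z, hz, rfl⟩
        have hd : dist (piE p0 p1 y) (piE p0 p1 z) ≤ ee p0 p1 c u :=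
          Metric.dist_le_diam_of_mem (piE_bdd h0 h1 _) ⟨y, hy, rfl⟩ ⟨z, hz, rfl⟩
        rw [Real.dist_eq, piE_sub h0 h1 (pre_inj (hz.2.trans hy.2.symm)), hz.2, abs_mul,
          abs_of_pos hwu] at hd
        have := hd.trans_lt hs
        rw [mul_comm] at this
        exact lt_of_mul_lt_mul_right this hwu.le
    let V := (WW K).filter fun v => (CC p0 p1 c (u ++ v)).Nonempty
    have hV : V.card ≤ K + 1 := by
      refine le_trans ?_ hcard
      rw [← Set.ncard_coe_finset]
      refine Set.ncard_le_ncard ?_ (finite_len K _ ?_)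
      · intro v hv
        obtain ⟨hvW, y, hy⟩ := Finset.mem_filter.1 hv
        obtain ⟨k1, k2⟩ := CC_append_pre hy
        rw [mem_WW.1 hvW] at k2
        exact ⟨_, ⟨y, k1, rfl⟩, k2⟩
      · rintro _ ⟨y, -, rfl⟩; exact length_pre _ _
    have e1 : ∑ v ∈ WW K, zz p0 p1 c (u ++ v) = ∑ v ∈ V, zz p0 p1 c (u ++ v) := by
      rw [Finset.sum_filter]
      refine Finset.sum_congr rfl fun v _ => ?_
      unfold zz; split_ifs <;> rfl
    have e2 : ∀ v ∈ V, zz p0 p1 c (u ++ v) ≤ (lam p0 p1)⁻¹ ^ K * zz p0 p1 c u := by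
      intro v hv
      obtain ⟨hvW, y, hy⟩ := Finset.mem_filter.1 hv
      have n1 : (CC p0 p1 c (u ++ v)).Nonempty := ⟨y, hy⟩
      have n2 : (CC p0 p1 c u).Nonempty := ⟨y, (CC_append_pre hy).1⟩
      rw [zz, zz, if_pos n1, if_pos n2, wt_append, mul_comm]
      have := wt_le h0 h1 v
      rw [mem_WW.1 hvW] at this
      gcongr
    rw [e1]
    have e3 := Finset.sum_le_card_nsmul V _ _ e2
    rw [nsmul_eq_mul] at e3
    have e4 : (V.card : ℝ) ≤ K + 1 := by exact_mod_cast hV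
    have e5 : 0 ≤ (lam p0 p1)⁻¹ ^ K * zz p0 p1 c u := by positivity
    have e6 : 0 ≤ 2 ^ K / ε * ee p0 p1 c u := by positivity
    nlinarith [mul_le_mul_of_nonneg_right e4 e5]
  · have hs' := not_lt.1 hs
    have e2 : ∀ v ∈ WW K, zz p0 p1 c (u ++ v) ≤ wt p0 p1 u := by
      intro v hv
      unfold zz; split_ifs
      · rw [wt_append]
        exact mul_le_of_le_one_right hwu.le (wt_le_one h0 h1 v)
      · exact hwu.le
    have e3 := Finset.sum_le_card_nsmul (WW K) _ _ e2
    rw [nsmul_eq_mul, card_WW] at e3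
    push_cast at e3
    have e5 : 0 ≤ (K + 1) * (lam p0 p1)⁻¹ ^ K * zz p0 p1 c u := by positivity
    have e6 : wt p0 p1 u ≤ ee p0 p1 c u / ε := by rw [le_div_iff₀ hε]; linarith
    calc _ ≤ 2 ^ K * wt p0 p1 u := e3
      _ ≤ 2 ^ K * (ee p0 p1 c u / ε) := by gcongr
      _ = 2 ^ K / ε * ee p0 p1 c u := by ring
      _ ≤ _ := by linarith

theorem exists_K {r : ℝ} (hr : 0 ≤ r) (hr1 : r < 1) : ∃ K : ℕ, 1 ≤ K ∧ (K + 1) * r ^ K ≤ 1 / 2 := by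
  have h1 := tendsto_self_mul_const_pow_of_lt_one hr hr1
  have h2 := tendsto_pow_atTop_nhds_zero_of_lt_one hr hr1
  have h3 := h1.add h2
  rw [add_zero] at h3
  obtain ⟨K, hK, hK1⟩ := ((h3.eventually_le_const (by norm_num : (0:ℝ) < 1 / 2)).and
    (eventually_ge_atTop 1)).exists
  exact ⟨K, hK1, by linarith⟩

theorem Z_bound {p0 p1 : ℝ} (c : ℝ) (h0 : 1 < p0) (h1 : 1 < p1) (hg : Good p0 p1) :
    ∃ K : ℕ, 1 ≤ K ∧ ∃ B : ℝ, 0 ≤ B ∧ ∀ j : ℕ, ∑ w ∈ WW (j * K), zz p0 p1 c w ≤ B := by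
  have hl := lam_gt_one h0 h1
  obtain ⟨d, hd⟩ : ∃ d, ∀ v, off p0 p1 (d :: v) + wt p0 p1 (d :: v) * c ≠ c := by
    by_contra hcon
    push Not at hcon
    obtain ⟨v0, hv0⟩ := hcon false
    obtain ⟨v1, hv1⟩ := hcon true
    exact hg v0 v1 c ⟨hv0, hv1⟩
  obtain ⟨K, hK1, hK⟩ := exists_K (r := (lam p0 p1)⁻¹) (by positivity) (inv_lt_one_of_one_lt₀ hl)
  obtain ⟨ε, hε, hY⟩ := unif_card h0 h1 hd K
  have hM := Mx_pos h1
  refine ⟨K, hK1, 1 + 2 * (2 ^ K / ε * Mx p1), by positivity, fun j => ?_⟩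
  induction j with
  | zero =>
    have : zz p0 p1 c [] ≤ 1 := by
      unfold zz; split_ifs <;> simp [wt]
    have h3 : 0 ≤ 2 ^ K / ε * Mx p1 := by positivity
    simp only [zero_mul, WW, Finset.sum_singleton]
    linarith
  | succ j ih =>
    rw [show (j + 1) * K = j * K + K by ring, sum_WW_add]
    have h2 := Finset.sum_le_sum fun u (_ : u ∈ WW (j * K)) => inner_bound h0 h1 hε hY u
    rw [Finset.sum_add_distrib, ← Finset.mul_sum, ← Finset.mul_sum] at h2
    have h3 : 2 ^ K / ε * ∑ w ∈ WW (j * K), ee p0 p1 c w ≤ 2 ^ K / ε * Mx p1 :=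
      mul_le_mul_of_nonneg_left (ee_sum' c h0 h1 _) (by positivity)
    have h4 : 0 ≤ ∑ w ∈ WW (j * K), zz p0 p1 c w := Finset.sum_nonneg fun w _ => zz_nonneg c h0 h1 w
    have h5 := mul_le_mul_of_nonneg_right hK h4
    linarith

theorem L6 {q0 q1 t c : ℝ} (h0 : 1 < q0) (h1 : 1 < q1) (ht : 0 < t)
    (hg : Good (q0 ^ t) (q1 ^ t)) {S : Set (ℕ → Bool)} (hS : S ⊆ XX (q0 ^ t) (q1 ^ t) c) :
    dimH (piE q0 q1 '' S) ≤ ENNReal.ofReal t := by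
  have h0' := rpow_gt_one h0 ht
  have h1' := rpow_gt_one h1 ht
  have hl := lam_gt_one h0 h1
  have hM := Mx_pos h1
  obtain ⟨K, hK, B, hB, hZ⟩ := Z_bound c h0' h1' hg
  have hdiam : ∀ w, Metric.ediam (piE q0 q1 '' CC (q0 ^ t) (q1 ^ t) c w) ≤
      ENNReal.ofReal (wt q0 q1 w * Mx q1) := by
    intro w
    refine Metric.ediam_le ?_
    rintro _ ⟨y, hy, rfl⟩ _ ⟨z, hz, rfl⟩
    rw [edist_dist]
    refine ENNReal.ofReal_le_ofReal ?_
    have hw := wt_pos h0 h1 w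
    rw [Real.dist_eq, piE_sub h0 h1 (pre_inj (hz.2.trans hy.2.symm)), hz.2, abs_mul,
      abs_of_pos hw]
    refine mul_le_mul_of_nonneg_left ?_ hw.le
    rw [abs_le]
    constructor <;> linarith [piE_nonneg h0 h1 (shiftTail y w.length),
      piE_nonneg h0 h1 (shiftTail z w.length), piE_le h0 h1 (shiftTail y w.length),
      piE_le h0 h1 (shiftTail z w.length)]
  have hdiam2 : ∀ w, Metric.ediam (piE q0 q1 '' CC (q0 ^ t) (q1 ^ t) c w) ^ t ≤
      ENNReal.ofReal (Mx q1 ^ t * zz (q0 ^ t) (q1 ^ t) c w) := by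
    intro w
    by_cases hne : (CC (q0 ^ t) (q1 ^ t) c w).Nonempty
    · have hw := wt_pos h0 h1 w
      rw [zz, if_pos hne, wt_rpow h0 h1]
      refine (ENNReal.rpow_le_rpow (hdiam w) ht.le).trans ?_
      rw [ENNReal.ofReal_rpow_of_nonneg (by positivity) ht.le, Real.mul_rpow hw.le hM.le, mul_comm]
    · rw [Set.not_nonempty_iff_eq_empty.1 hne, Set.image_empty, Metric.ediam_empty,
        ENNReal.zero_rpow_of_pos ht]
      exact zero_le
  have hmeas : MeasureTheory.Measure.hausdorffMeasure t (piE q0 q1 '' S) ≤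
      ENNReal.ofReal (Mx q1 ^ t * B) := by
    refine (MeasureTheory.Measure.hausdorffMeasure_le_liminf_sum (l := atTop)
      (ι := fun j : ℕ => {w // w ∈ WW (j * K)}) t _
      (fun j => ENNReal.ofReal ((lam q0 q1)⁻¹ ^ (j * K) * Mx q1)) ?_
      (fun j w => piE q0 q1 '' CC (q0 ^ t) (q1 ^ t) c w.1) ?_ ?_).trans ?_
    · rw [← ENNReal.ofReal_zero]
      refine ENNReal.tendsto_ofReal ?_
      rw [← zero_mul (Mx q1)]
      refine Tendsto.mul_const _ ?_
      refine (tendsto_pow_atTop_nhds_zero_of_lt_one (by positivity)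
        (inv_lt_one_of_one_lt₀ hl)).comp ?_
      exact tendsto_atTop_mono (fun j => Nat.le_mul_of_pos_right j hK) tendsto_id
    · refine Eventually.of_forall fun j w => (hdiam w.1).trans (ENNReal.ofReal_le_ofReal ?_)
      have := wt_le h0 h1 w.1
      rw [mem_WW.1 w.2] at this
      gcongr
    · refine Eventually.of_forall fun j => ?_
      rintro _ ⟨y, hy, rfl⟩
      refine Set.mem_iUnion.2 ⟨⟨pre (j * K) y, mem_WW.2 (length_pre _ _)⟩, y, ⟨hS hy, ?_⟩, rfl⟩
      simp only [length_pre]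
    · refine (liminf_le_liminf (v := fun _ => ENNReal.ofReal (Mx q1 ^ t * B))
        (Eventually.of_forall fun j => ?_)).trans_eq (liminf_const _)
      refine (Finset.sum_le_sum fun w _ => hdiam2 w.1).trans ?_
      rw [← ENNReal.ofReal_sum_of_nonneg]
      · refine ENNReal.ofReal_le_ofReal ?_
        rw [← Finset.mul_sum,
          Finset.sum_coe_sort (WW (j * K)) (fun w => zz (q0 ^ t) (q1 ^ t) c w)]
        exact mul_le_mul_of_nonneg_left (hZ j) (by positivity)
      · intro w _
        exact mul_nonneg (by positivity) (zz_nonneg c h0' h1' _)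
  have hfin : MeasureTheory.Measure.hausdorffMeasure ((Real.toNNReal t : NNReal) : ℝ)
      (piE q0 q1 '' S) ≠ ⊤ := by
    rw [Real.coe_toNNReal _ ht.le]
    exact ne_top_of_le_ne_top ENNReal.ofReal_ne_top hmeas
  exact dimH_le_of_hausdorffMeasure_ne_top hfin

/-- Theorem 3: for fixed `q₀,q₁ > 1`, the map `(a,b) ↦ dim_H π_{q₀,q₁}(Ω_{a,b})` is continuous
on `0{0,1}^ℕ × 1{0,1}^ℕ` (product topology on `{0,1}^ℕ`). -/
theorem stmt7 (q0 q1 : ℝ) (hq0 : 1 < q0) (hq1 : 1 < q1) :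
    ContinuousOn (fun p : (ℕ → Bool) × (ℕ → Bool) => dimH (piE q0 q1 '' Omega p.1 p.2))
      ({a : ℕ → Bool | a 0 = false} ×ˢ {b : ℕ → Bool | b 0 = true}) := by
  rintro ⟨a, b⟩ ⟨ha, hb⟩
  change a 0 = false at ha
  change b 0 = true at hb
  have hD1 := dimH_le_one (piE q0 q1 '' Omega a b)
  refine tendsto_order.2 ⟨fun r hr => ?_, fun r hr => ?_⟩
  · -- lower semicontinuity
    change r < dimH (piE q0 q1 '' Omega a b) at hr
    have hDt : dimH (piE q0 q1 '' Omega a b) ≠ ⊤ := ne_top_of_le_ne_top ENNReal.one_ne_top hD1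
    have hrt : r ≠ ⊤ := ne_top_of_lt hr
    have hlt : r.toReal < (dimH (piE q0 q1 '' Omega a b)).toReal :=
      (ENNReal.toReal_lt_toReal hrt hDt).2 hr
    obtain ⟨t, ht1, ht2, hgood⟩ := exists_good hq0 hq1 hlt
    have ht0 : 0 < t := ENNReal.toReal_nonneg.trans_lt ht1
    have htD : ENNReal.ofReal t < dimH (piE q0 q1 '' Omega a b) :=
      (ENNReal.ofReal_lt_iff_lt_toReal ht0.le hDt).2 ht2
    have hrt' : r < ENNReal.ofReal t := (ENNReal.lt_ofReal_iff_toReal_lt hrt).2 ht1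
    have htle : t ≤ 1 := by
      refine ht2.le.trans ?_
      have := ENNReal.toReal_mono ENNReal.one_ne_top hD1
      simpa using this
    have h0' := rpow_gt_one hq0 ht0
    have h1' := rpow_gt_one hq1 ht0
    have hI : 1 / q1 ^ t ≤ Mx (q1 ^ t) / q0 ^ t := by
      by_contra hcon
      have hG : Gap (q0 ^ t) (q1 ^ t) a b := by
        intro u _ v _ hu hv
        exact ((piE_false_le h0' h1' hu).trans_lt (not_le.1 hcon)).trans_le
          (piE_true_ge h0' h1' hv)
      exact absurd (L4 hq0 hq1 ht0 hG) (not_le.2 htD)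
    have hU : ¬ UU (q0 ^ t) (q1 ^ t) a b := by
      rintro ⟨c, -, a', ha', b', hb', ha0, hb0, haa, hbb⟩
      exact absurd (L6 hq0 hq1 ht0 hgood
        (Omega_subset_XX h0' h1' ha hb ha' hb' ha0 hb0 haa hbb)) (not_le.2 htD)
    have hev : ∀ᶠ p in 𝓝 (a, b), ¬ UU (q0 ^ t) (q1 ^ t) p.1 p.2 :=
      (UU_closed h0' h1').isOpen_compl.mem_nhds hU
    filter_upwards [nhdsWithin_le_nhds hev, self_mem_nhdsWithin] with p hp hpm
    have hL : LL (q0 ^ t) (q1 ^ t) p.1 p.2 := by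
      by_contra hn
      exact hp (UU_of_not_LL h0' h1' hpm.1 hpm.2 hI hn)
    exact hrt'.trans_le (L5 hq0 hq1 ht0 htle hpm.1 hpm.2 hL)
  · -- upper semicontinuity
    change dimH (piE q0 q1 '' Omega a b) < r at hr
    by_cases hr1 : 1 < r
    · exact Eventually.of_forall fun p => (dimH_le_one _).trans_lt hr1
    have hDt : dimH (piE q0 q1 '' Omega a b) ≠ ⊤ := ne_top_of_le_ne_top ENNReal.one_ne_top hD1
    have hrt : r ≠ ⊤ := ne_top_of_le_ne_top ENNReal.one_ne_top (not_lt.1 hr1)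
    have hlt : (dimH (piE q0 q1 '' Omega a b)).toReal < r.toReal :=
      (ENNReal.toReal_lt_toReal hDt hrt).2 hr
    obtain ⟨t, ht1, ht2⟩ := exists_between hlt
    have ht0 : 0 < t := ENNReal.toReal_nonneg.trans_lt ht1
    have htD : dimH (piE q0 q1 '' Omega a b) < ENNReal.ofReal t :=
      (ENNReal.lt_ofReal_iff_toReal_lt hDt).2 ht1
    have hrt' : ENNReal.ofReal t < r := (ENNReal.ofReal_lt_iff_lt_toReal ht0.le hrt).2 ht2
    have htle : t ≤ 1 := by
      refine ht2.le.trans ?_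
      have := ENNReal.toReal_mono ENNReal.one_ne_top (not_lt.1 hr1)
      simpa using this
    have h0' := rpow_gt_one hq0 ht0
    have h1' := rpow_gt_one hq1 ht0
    have hG : Gap (q0 ^ t) (q1 ^ t) a b := by
      rcases LL_or_Gap h0' h1' ha hb with h | h
      · exact absurd (L5 hq0 hq1 ht0 htle ha hb h) (not_le.2 htD)
      · exact h
    have hev : ∀ᶠ p in 𝓝 (a, b), Gap (q0 ^ t) (q1 ^ t) p.1 p.2 :=
      (Gap_compl_closed h0' h1').mem_nhds hG
    filter_upwards [nhdsWithin_le_nhds hev] with p hp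
    exact (L4 hq0 hq1 ht0 hp).trans_lt hrt'
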